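/- arXiv:1307.4886 — 2 statements merged into one kernel-verified Lean document; each statement's English description precedes it below -/
import Mathlib

section
/- Let u : D → ℝ be measurable on a bounded domain D ⊂ ℝⁿ with u ∈ L^p(D) for some p ≥ 1, and suppose ∫_{D×D} |u(x) − u(y)|^p / |x−y|^{n+σp} dx dy < ∞ for some σ > 1. Then u is almost everywhere equal to a constant. -/
open MeasureTheory Metric Set
open scoped ENNReal NNReal RealInnerProductSpace Pointwise

noncomputable section

abbrev Euc (n : ℕ) := EuclideanSpace ℝ (Fin n)

variable {n : ℕ}

noncomputable def pderiv (i : Fin n) (f : Euc n → ℝ) : Euc n → ℝ :=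
  fun x => fderiv ℝ f x (EuclideanSpace.single i (1 : ℝ))

noncomputable def multiDeriv (α : Fin n → ℕ) (f : Euc n → ℝ) : Euc n → ℝ :=
  (List.finRange n).foldr (fun i g => (pderiv i)^[α i] g) f

def degree (α : Fin n → ℕ) : ℕ := ∑ i, α i

def IsWeakDeriv (D : Set (Euc n)) (α : Fin n → ℕ) (u g : Euc n → ℝ) : Prop :=
  ∀ φ : Euc n → ℝ, ContDiff ℝ (⊤ : ℕ∞) φ → HasCompactSupport φ → tsupport φ ⊆ D →
    ∫ x in D, u x * multiDeriv α φ x = (-1 : ℝ) ^ (degree α) * ∫ x in D, g x * φ x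

def cone (a h : ℝ) (v : Euc n) : Set (Euc n) :=
  {x | 0 < ⟪x, v⟫ ∧ ⟪x, v⟫ < h ∧ ‖x - ⟪x, v⟫ • v‖ < a * ⟪x, v⟫}

def IsConeType (D : Set (Euc n)) : Prop :=
  ∃ a h : ℝ, 0 < a ∧ 0 < h ∧
    ∃ (m : ℕ) (U : Fin m → Set (Euc n)) (v : Fin m → Euc n),
      (∀ j, IsOpen (U j)) ∧ (∀ j, ‖v j‖ = 1) ∧
      frontier D ⊆ ⋃ j, U j ∧
      ∀ j, (U j ∩ D) + cone a h (v j) ⊆ D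

def HolderClassOn (t : ℝ) (f : Euc n → ℝ) (V : Set (Euc n)) : Prop :=
  ContDiffOn ℝ (⌊t⌋₊ : ℕ) f V ∧
  ∀ α : Fin n → ℕ, degree α ≤ ⌊t⌋₊ →
    ∃ K : ℝ, (∀ x ∈ V, |multiDeriv α f x| ≤ K) ∧
      ∀ x ∈ V, ∀ y ∈ V,
        |multiDeriv α f x - multiDeriv α f y| ≤ K * ‖x - y‖ ^ (t - ⌊t⌋₊)

def LocallyHolderClassOn (t : ℝ) (f : Euc n → ℝ) (D : Set (Euc n)) : Prop :=
  ∀ x ∈ D, ∃ V, V ⊆ D ∧ IsOpen V ∧ IsConnected V ∧ x ∈ V ∧ HolderClassOn t f V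

noncomputable def sobolevNormP (p s : ℝ) (D : Set (Euc n))
    (u : Euc n → ℝ) (g : (Fin n → ℕ) → Euc n → ℝ) : ℝ≥0∞ :=
  (∫⁻ x in D, ENNReal.ofReal (|u x| ^ p)) +
  ∑' α : {α : Fin n → ℕ // degree α = ⌊s⌋₊},
    ∫⁻ q in D ×ˢ D,
      ENNReal.ofReal
        (|g α.1 q.1 - g α.1 q.2| ^ p / ‖q.1 - q.2‖ ^ ((n : ℝ) + (s - ⌊s⌋₊) * p))


/-- The integrand of the Gagliardo energy of `u` with powers `p` and `a`. -/
def gagliardoIntegrand {E : Type*} [NormedAddCommGroup E] (u : E → ℝ) (p a : ℝ) (x y : E) : ℝ≥0∞ :=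
  ENNReal.ofReal (|u x - u y| ^ p / ‖x - y‖ ^ a)

theorem gagliardoIntegrand_comm {E : Type*} [NormedAddCommGroup E] (u : E → ℝ) (p a : ℝ)
    (x y : E) : gagliardoIntegrand u p a x y = gagliardoIntegrand u p a y x := by
  simp only [gagliardoIntegrand, abs_sub_comm (u x), norm_sub_rev x]

theorem Measurable.gagliardoIntegrand {α E : Type*} [MeasurableSpace α] [NormedAddCommGroup E]
    [SecondCountableTopology E] [MeasurableSpace E] [BorelSpace E] {u : E → ℝ}
    (hu : Measurable u) (p a : ℝ) {f g : α → E} (hf : Measurable f) (hg : Measurable g) :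
    Measurable fun z => gagliardoIntegrand u p a (f z) (g z) := by
  unfold _root_.gagliardoIntegrand
  fun_prop

theorem measurable_uncurry_gagliardoIntegrand {E : Type*} [NormedAddCommGroup E]
    [SecondCountableTopology E] [MeasurableSpace E] [BorelSpace E] {u : E → ℝ}
    (hu : Measurable u) (p a : ℝ) :
    Measurable (Function.uncurry (gagliardoIntegrand u p a)) :=
  hu.gagliardoIntegrand p a measurable_fst measurable_snd

theorem lintegral_lintegral_add_swap {α : Type*} [MeasurableSpace α] {μ : Measure α} [SFinite μ]
    {f : α → α → ℝ≥0∞} (hf : Measurable (Function.uncurry f)) :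
    ∫⁻ x, ∫⁻ y, (f x y + f y x) ∂μ ∂μ = 2 * ∫⁻ x, ∫⁻ y, f x y ∂μ ∂μ := by
  have h (x : α) : ∫⁻ y, (f x y + f y x) ∂μ = ∫⁻ y, f x y ∂μ + ∫⁻ y, f y x ∂μ :=
    lintegral_add_left (hf.comp measurable_prodMk_left) _
  have hfI : Measurable fun x => ∫⁻ y, f x y ∂μ := hf.lintegral_prod_right'
  rw [lintegral_congr h, lintegral_add_left hfI,
    ← lintegral_lintegral_swap hf.aemeasurable, two_mul]

theorem abs_sub_rpow_le_mul_add {p : ℝ} (hp : 1 ≤ p) (a b c : ℝ) :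
    |a - c| ^ p ≤ 2 ^ (p - 1) * (|a - b| ^ p + |b - c| ^ p) := by
  calc |a - c| ^ p ≤ (|a - b| + |b - c|) ^ p := by
        gcongr
        exact abs_sub_le a b c
    _ ≤ _ := by
        have h := NNReal.rpow_add_le_mul_rpow_add_rpow ‖a - b‖₊ ‖b - c‖₊ hp
        exact_mod_cast h

theorem gagliardoIntegrand_le_midpoint {E : Type*} [NormedAddCommGroup E] [NormedSpace ℝ E]
    (u : E → ℝ) {p : ℝ} (a : ℝ) (hp : 1 ≤ p) (x y : E) :
    gagliardoIntegrand u p a x y ≤ ENNReal.ofReal (2 ^ (p - 1 - a)) *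
      (gagliardoIntegrand u p a x (midpoint ℝ x y) +
        gagliardoIntegrand u p a y (midpoint ℝ y x)) := by
  have hx : ‖x - midpoint ℝ x y‖ = ‖x - y‖ / 2 := by
    rw [← dist_eq_norm, dist_left_midpoint, dist_eq_norm, Real.norm_two]; ring
  have hy : ‖y - midpoint ℝ y x‖ = ‖x - y‖ / 2 := by
    rw [← dist_eq_norm, dist_left_midpoint, dist_eq_norm, Real.norm_two, norm_sub_rev]; ring
  unfold gagliardoIntegrand
  rw [← ENNReal.ofReal_add (by positivity) (by positivity),
    ← ENNReal.ofReal_mul (by positivity), hx, hy, Real.div_rpow (norm_nonneg _) zero_le_two,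
    midpoint_comm y x, abs_sub_comm (u y)]
  refine ENNReal.ofReal_le_ofReal ?_
  have h2 : (0 : ℝ) < 2 ^ a := by positivity
  calc _ ≤ 2 ^ (p - 1) * (|u x - u (midpoint ℝ x y)| ^ p + |u (midpoint ℝ x y) - u y| ^ p) /
        ‖x - y‖ ^ a := by
        gcongr
        exact abs_sub_rpow_le_mul_add hp _ _ _
    _ = _ := by
        simp only [Real.rpow_sub two_pos (p - 1) a, div_div_eq_mul_div]
        field_simp

section FiniteDimensional

variable {E : Type*} [NormedAddCommGroup E] [NormedSpace ℝ E] [FiniteDimensional ℝ E]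
  [MeasurableSpace E] [BorelSpace E]

theorem lintegral_comp_midpoint (μ : Measure E) [μ.IsAddHaarMeasure] {g : E → ℝ≥0∞}
    (hg : Measurable g) (x : E) :
    ∫⁻ y, g (midpoint ℝ x y) ∂μ =
      ENNReal.ofReal (2 ^ (Module.finrank ℝ E : ℝ)) * ∫⁻ y, g y ∂μ := by
  simp only [midpoint_eq_smul_add, add_comm x]
  rw [lintegral_add_right_eq_self (fun y => g ((⅟2 : ℝ) • y)) x,
    ← lintegral_map (f := g) hg (measurable_const_smul (⅟2 : ℝ)),
    Measure.map_addHaar_smul μ (by norm_num), lintegral_smul_measure, smul_eq_mul]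
  congr 2
  rw [Real.rpow_natCast, invOf_eq_inv, inv_pow, inv_inv, abs_of_pos (by positivity)]

theorem setLIntegral_comp_midpoint_le (μ : Measure E) [μ.IsAddHaarMeasure] {g : E → ℝ≥0∞}
    (hg : Measurable g) {s : Set E} (hs : Convex ℝ s) (hsm : MeasurableSet s) {x : E}
    (hx : x ∈ s) :
    ∫⁻ y in s, g (midpoint ℝ x y) ∂μ ≤
      ENNReal.ofReal (2 ^ (Module.finrank ℝ E : ℝ)) * ∫⁻ y in s, g y ∂μ := by
  rw [← lintegral_indicator hsm g, ← lintegral_comp_midpoint μ (hg.indicator hsm) x,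
    ← lintegral_indicator hsm]
  refine lintegral_mono fun y => indicator_le (g := fun y => s.indicator g (midpoint ℝ x y))
    (fun y hy => ?_) y
  rw [indicator_of_mem (hs.midpoint_mem hx hy)]

theorem lintegral_gagliardoIntegrand_le_midpoint (μ : Measure E) [SFinite μ] {u : E → ℝ}
    (hu : Measurable u) {p : ℝ} (a : ℝ) (hp : 1 ≤ p) (s : Set E) :
    ∫⁻ x in s, ∫⁻ y in s, gagliardoIntegrand u p a x y ∂μ ∂μ ≤
      ENNReal.ofReal (2 ^ (p - 1 - a)) *
        (2 * ∫⁻ x in s, ∫⁻ y in s, gagliardoIntegrand u p a x (midpoint ℝ x y) ∂μ ∂μ) := by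
  have hmid : Measurable fun q : E × E => midpoint ℝ q.1 q.2 := by
    simp only [midpoint_eq_smul_add]; fun_prop
  rw [← lintegral_lintegral_add_swap
      (f := fun x y => gagliardoIntegrand u p a x (midpoint ℝ x y))
      (hu.gagliardoIntegrand p a measurable_fst hmid),
    ← lintegral_const_mul' _ _ ENNReal.ofReal_ne_top]
  refine lintegral_mono fun x => ?_
  rw [← lintegral_const_mul' _ _ ENNReal.ofReal_ne_top]
  exact lintegral_mono fun y => gagliardoIntegrand_le_midpoint u a hp x y

theorem lintegral_gagliardoIntegrand_midpoint_le (μ : Measure E) [μ.IsAddHaarMeasure]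
    {u : E → ℝ} (hu : Measurable u) (p a : ℝ) {s : Set E} (hs : Convex ℝ s)
    (hsm : MeasurableSet s) :
    ∫⁻ x in s, ∫⁻ y in s, gagliardoIntegrand u p a x (midpoint ℝ x y) ∂μ ∂μ ≤
      ENNReal.ofReal (2 ^ (Module.finrank ℝ E : ℝ)) *
        ∫⁻ x in s, ∫⁻ y in s, gagliardoIntegrand u p a x y ∂μ ∂μ := by
  rw [← lintegral_const_mul' _ _ ENNReal.ofReal_ne_top]
  refine setLIntegral_mono' hsm fun x hx => ?_
  exact setLIntegral_comp_midpoint_le μ (g := gagliardoIntegrand u p a x)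
    (hu.gagliardoIntegrand p a measurable_const measurable_id) hs hsm hx

theorem lintegral_gagliardoIntegrand_eq_zero (μ : Measure E) [μ.IsAddHaarMeasure] {u : E → ℝ}
    (hu : Measurable u) {p a : ℝ} (hp : 1 ≤ p) (ha : Module.finrank ℝ E + p < a) {s : Set E}
    (hs : Convex ℝ s) (hsm : MeasurableSet s)
    (hfin : ∫⁻ x in s, ∫⁻ y in s, gagliardoIntegrand u p a x y ∂μ ∂μ ≠ ⊤) :
    ∫⁻ x in s, ∫⁻ y in s, gagliardoIntegrand u p a x y ∂μ ∂μ = 0 := by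
  have hIJ := lintegral_gagliardoIntegrand_le_midpoint μ hu a hp s
  have hJI := lintegral_gagliardoIntegrand_midpoint_le μ hu p a hs hsm
  generalize ∫⁻ x in s, ∫⁻ y in s, gagliardoIntegrand u p a x y ∂μ ∂μ = I at *
  have hle : I ≤ ENNReal.ofReal (2 ^ (p - a + Module.finrank ℝ E)) * I := by
    calc I ≤ ENNReal.ofReal (2 ^ (p - 1 - a)) *
          (ENNReal.ofReal 2 * (ENNReal.ofReal (2 ^ (Module.finrank ℝ E : ℝ)) * I)) := by
          refine hIJ.trans ?_
          rw [ENNReal.ofReal_ofNat]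
          gcongr
      _ = _ := by
          rw [← mul_assoc, ← mul_assoc, ← ENNReal.ofReal_mul (by positivity),
            ← ENNReal.ofReal_mul (by positivity), ← Real.rpow_add_one two_ne_zero,
            ← Real.rpow_add two_pos]
          ring_nf
  by_contra h0
  refine hle.not_gt ?_
  have hlt : ENNReal.ofReal (2 ^ (p - a + Module.finrank ℝ E)) < 1 := by
    rw [ENNReal.ofReal_lt_one]
    exact Real.rpow_lt_one_of_one_lt_of_neg one_lt_two (by linarith)
  simpa using ENNReal.mul_lt_mul_left h0 hfin hlt

theorem exists_ae_eq_const_of_convex (μ : Measure E) [μ.IsAddHaarMeasure] {u : E → ℝ}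
    (hu : Measurable u) {p a : ℝ} (hp : 1 ≤ p) (ha : Module.finrank ℝ E + p < a) {s : Set E}
    (hs : Convex ℝ s) (hsm : MeasurableSet s)
    (hfin : ∫⁻ x in s, ∫⁻ y in s, gagliardoIntegrand u p a x y ∂μ ∂μ ≠ ⊤) :
    ∃ c : ℝ, ∀ᵐ x ∂μ.restrict s, u x = c := by
  have hF := measurable_uncurry_gagliardoIntegrand hu p a
  have h0 := lintegral_gagliardoIntegrand_eq_zero μ hu hp ha hs hsm hfin
  have hFI : Measurable fun x => ∫⁻ y in s, gagliardoIntegrand u p a x y ∂μ :=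
    hF.lintegral_prod_right'
  rw [lintegral_eq_zero_iff hFI] at h0
  rcases (ae (μ.restrict s)).eq_or_neBot with hbot | hbot
  · exact ⟨0, by simp [hbot]⟩
  obtain ⟨x, hx⟩ := h0.exists
  have hx' := (lintegral_eq_zero_iff (hu.gagliardoIntegrand p a measurable_const measurable_id)).1 hx
  refine ⟨u x, hx'.mono fun y hy => ?_⟩
  by_contra hne
  have hxy : x ≠ y := fun h => hne (by rw [h])
  have h1 : 0 < |u x - u y| := abs_pos.2 (sub_ne_zero.2 (Ne.symm hne))
  have h2 : 0 < ‖x - y‖ := norm_pos_iff.2 (sub_ne_zero.2 hxy)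
  have h3 : |u x - u y| ^ p / ‖x - y‖ ^ a ≤ 0 := ENNReal.ofReal_eq_zero.1 hy
  exact absurd h3 (not_le.2 (by positivity))

end FiniteDimensional

theorem IsPreconnected.exists_ae_eq_const {X Y : Type*} [TopologicalSpace X]
    [SecondCountableTopology X] [MeasurableSpace X] [OpensMeasurableSpace X] {μ : Measure X}
    [μ.IsOpenPosMeasure] [Nonempty Y] {s : Set X} (hs : IsPreconnected s) (hso : IsOpen s)
    {u : X → Y}
    (hloc : ∀ x ∈ s, ∃ t, IsOpen t ∧ x ∈ t ∧ ∃ c, ∀ᵐ y ∂μ.restrict t, u y = c) :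
    ∃ c, ∀ᵐ y ∂μ.restrict s, u y = c := by
  rcases s.eq_empty_or_nonempty with rfl | ⟨x₀, hx₀⟩
  · exact ⟨Classical.arbitrary Y, by simp⟩
  obtain ⟨t₀, ht₀, hxt₀, c, hc⟩ := hloc x₀ hx₀
  let A : Set X := ⋃₀ {t | IsOpen t ∧ ∀ᵐ y ∂μ.restrict t, u y = c}
  let B : Set X := ⋃₀ {t | IsOpen t ∧ ∃ d, d ≠ c ∧ ∀ᵐ y ∂μ.restrict t, u y = d}
  have hsA : s ⊆ A := by
    refine hs.subset_left_of_subset_union (v := B) (isOpen_sUnion fun t ht => ht.1)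
      (isOpen_sUnion fun t ht => ht.1) ?_ ?_ ⟨x₀, hx₀, t₀, ⟨ht₀, hc⟩, hxt₀⟩
    · rw [Set.disjoint_left]
      rintro x ⟨t, ⟨ht, htc⟩, hxt⟩ ⟨t', ⟨ht', d, hd, htd⟩, hxt'⟩
      have hpos : μ (t ∩ t') ≠ 0 := ((ht.inter ht').measure_pos μ ⟨x, hxt, hxt'⟩).ne'
      have : (ae (μ.restrict (t ∩ t'))).NeBot := by
        rwa [ae_neBot, Ne, Measure.restrict_eq_zero]
      obtain ⟨y, hyc, hyd⟩ := ((ae_restrict_of_ae_restrict_of_subset inter_subset_left htc).and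
        (ae_restrict_of_ae_restrict_of_subset inter_subset_right htd)).exists
      exact hd (hyd.symm.trans hyc)
    · intro x hx
      obtain ⟨t, ht, hxt, d, hd⟩ := hloc x hx
      by_cases hdc : d = c
      · exact Or.inl ⟨t, ⟨ht, hdc ▸ hd⟩, hxt⟩
      · exact Or.inr ⟨t, ⟨ht, d, hdc, hd⟩, hxt⟩
  refine ⟨c, ?_⟩
  rw [ae_restrict_iff' hso.measurableSet, ae_iff]
  refine measure_null_of_locally_null _ fun x hx => ?_
  have hxs : x ∈ s := by_contra fun h => hx fun h' => absurd h' h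
  obtain ⟨t, ⟨ht, htc⟩, hxt⟩ := hsA hxs
  rw [ae_restrict_iff' ht.measurableSet, ae_iff] at htc
  refine ⟨_, Filter.inter_mem self_mem_nhdsWithin (mem_nhdsWithin_of_mem_nhds (ht.mem_nhds hxt)),
    measure_mono_null ?_ htc⟩
  rintro y ⟨hy, hyt⟩ hy'
  exact hy fun _ => hy' hyt

/-- If the Gagliardo seminorm of `u ∈ L^p(D)` with exponent `σ > 1` is finite on a
bounded domain, then `u` is a.e. equal to a constant. -/
theorem stmt5 {n : ℕ} (D : Set (Euc n)) (hne : D.Nonempty) (hopen : IsOpen D)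
    (hconn : IsConnected D) (hbdd : Bornology.IsBounded D)
    (u : Euc n → ℝ) (hu : Measurable u)
    (p σ : ℝ) (hp : 1 ≤ p) (hσ : 1 < σ)
    (hLp : ∫⁻ x in D, ENNReal.ofReal (|u x| ^ p) < ⊤)
    (hGag : ∫⁻ q in D ×ˢ D,
        ENNReal.ofReal (|u q.1 - u q.2| ^ p / ‖q.1 - q.2‖ ^ ((n : ℝ) + σ * p))
        ∂(volume : Measure (Euc n × Euc n)) < ⊤) :
    ∃ c : ℝ, ∀ᵐ x ∂(volume.restrict D), u x = c := by
  refine hconn.isPreconnected.exists_ae_eq_const hopen fun x hx => ?_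
  obtain ⟨r, hr, hrD⟩ := Metric.isOpen_iff.1 hopen x hx
  refine ⟨ball x r, isOpen_ball, mem_ball_self hr,
    exists_ae_eq_const_of_convex volume hu (a := n + σ * p) hp ?_ (convex_ball x r)
      measurableSet_ball ?_⟩
  · rw [finrank_euclideanSpace_fin]
    nlinarith
  · have h := (lintegral_mono_set (Set.prod_mono hrD hrD)).trans_lt hGag
    have hF := measurable_uncurry_gagliardoIntegrand hu p (n + σ * p)
    rw [Measure.volume_eq_prod, ← Measure.prod_restrict] at h
    exact ((lintegral_prod _ hF.aemeasurable).symm.trans_lt h).ne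

end
end

section
/- Let X : Ω × D → ℝ be a random field on a bounded domain D ⊂ ℝⁿ of cone type, with continuous sample paths, and suppose that for some s > 0 and p > 1, E(‖X‖^p_{W^s_p(D)}) < ∞. Then there exists Ω' ∈ F with P(Ω') = 1 such that the random field X̃ := 1_{Ω'} X is a modification of X, every sample path of X̃ belongs to W^s_p(D), and every sample path of X̃ belongs to C̄^t(D) for all t with t < s − n/p. -/
open MeasureTheory Metric Set
open scoped ENNReal NNReal RealInnerProductSpace Pointwise Manifold

noncomputable section

variable {n : ℕ}

open Filter Topology

/-! ### Partial derivatives of smooth functions -/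

theorem contDiff_pderiv {f : Euc n → ℝ} (hf : ContDiff ℝ (⊤ : ℕ∞) f) (i : Fin n) :
    ContDiff ℝ (⊤ : ℕ∞) (pderiv i f) :=
  (hf.fderiv_right (m := (⊤ : ℕ∞)) (by simp)).clm_apply contDiff_const

theorem contDiff_pderiv_iterate {f : Euc n → ℝ} (hf : ContDiff ℝ (⊤ : ℕ∞) f) (i : Fin n) (m : ℕ) :
    ContDiff ℝ (⊤ : ℕ∞) ((pderiv i)^[m] f) := by
  induction m with
  | zero => exact hf
  | succ m ih => rw [Function.iterate_succ_apply']; exact contDiff_pderiv ih i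

theorem pderiv_add {f g : Euc n → ℝ} (hf : ContDiff ℝ (⊤ : ℕ∞) f) (hg : ContDiff ℝ (⊤ : ℕ∞) g)
    (i : Fin n) : pderiv i (f + g) = pderiv i f + pderiv i g := by
  ext x
  simp only [pderiv, Pi.add_apply]
  rw [fderiv_add (hf.differentiable (by simp) x) (hg.differentiable (by simp) x)]
  rfl

theorem pderiv_zero (i : Fin n) : pderiv i (0 : Euc n → ℝ) = 0 := by
  ext x
  simp [pderiv]

theorem minSmoothness_two_le_smooth : minSmoothness ℝ 2 ≤ ((⊤ : ℕ∞) : WithTop ℕ∞) := by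
  simpa using WithTop.coe_le_coe.2 (le_top : (2 : ℕ∞) ≤ ⊤)

theorem pderiv_comm {f : Euc n → ℝ} (hf : ContDiff ℝ (⊤ : ℕ∞) f) (i j : Fin n) :
    pderiv i (pderiv j f) = pderiv j (pderiv i f) := by
  ext x
  have hd : Differentiable ℝ (fderiv ℝ f) :=
    (hf.fderiv_right (m := (⊤ : ℕ∞)) (by simp)).differentiable (by simp)
  have key : ∀ a b : Fin n, pderiv a (pderiv b f) x =
      fderiv ℝ (fderiv ℝ f) x (EuclideanSpace.single a 1) (EuclideanSpace.single b 1) := by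
    intro a b
    have hb : pderiv b f = fun y => fderiv ℝ f y (EuclideanSpace.single b 1) := rfl
    rw [pderiv, hb, fderiv_clm_apply (hd x) (differentiableAt_const _)]
    simp
  rw [key, key]
  exact (hf.contDiffAt.isSymmSndFDerivAt minSmoothness_two_le_smooth) _ _

theorem pderiv_iterate_comm {f : Euc n → ℝ} (hf : ContDiff ℝ (⊤ : ℕ∞) f) (i j : Fin n) (m : ℕ) :
    pderiv j ((pderiv i)^[m] f) = (pderiv i)^[m] (pderiv j f) := by
  induction m with
  | zero => rfl
  | succ m ih =>
    rw [Function.iterate_succ_apply', Function.iterate_succ_apply', ← ih,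
      pderiv_comm (contDiff_pderiv_iterate hf i m)]

theorem contDiff_foldr_pderiv {f : Euc n → ℝ} (hf : ContDiff ℝ (⊤ : ℕ∞) f) (α : Fin n → ℕ)
    (l : List (Fin n)) :
    ContDiff ℝ (⊤ : ℕ∞) (l.foldr (fun i g => (pderiv i)^[α i] g) f) := by
  induction l with
  | nil => exact hf
  | cons a l ih => exact contDiff_pderiv_iterate ih a _

theorem contDiff_multiDeriv {f : Euc n → ℝ} (hf : ContDiff ℝ (⊤ : ℕ∞) f) (α : Fin n → ℕ) :
    ContDiff ℝ (⊤ : ℕ∞) (multiDeriv α f) :=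
  contDiff_foldr_pderiv hf α _

theorem pderiv_multiDeriv {f : Euc n → ℝ} (hf : ContDiff ℝ (⊤ : ℕ∞) f) (α : Fin n → ℕ)
    (j : Fin n) : pderiv j (multiDeriv α f) = multiDeriv α (pderiv j f) := by
  unfold multiDeriv
  induction List.finRange n with
  | nil => rfl
  | cons a l ih =>
    rw [List.foldr_cons, List.foldr_cons, ← ih,
      pderiv_iterate_comm (contDiff_foldr_pderiv hf α l)]

theorem multiDeriv_add_single {f : Euc n → ℝ} (hf : ContDiff ℝ (⊤ : ℕ∞) f) (α : Fin n → ℕ)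
    (j : Fin n) : multiDeriv (α + Pi.single j 1) f = pderiv j (multiDeriv α f) := by
  have notMem : ∀ l : List (Fin n), j ∉ l →
      l.foldr (fun i g => (pderiv i)^[(α + Pi.single j 1 : Fin n → ℕ) i] g) f =
        l.foldr (fun i g => (pderiv i)^[α i] g) f := by
    intro l
    induction l with
    | nil => intro _; rfl
    | cons a l ih =>
      intro h
      rw [List.mem_cons, not_or] at h
      rw [List.foldr_cons, List.foldr_cons, ih h.2]
      simp [Pi.single_eq_of_ne (Ne.symm h.1)]
  have mem : ∀ l : List (Fin n), l.Nodup → j ∈ l →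
      l.foldr (fun i g => (pderiv i)^[(α + Pi.single j 1 : Fin n → ℕ) i] g) f =
        pderiv j (l.foldr (fun i g => (pderiv i)^[α i] g) f) := by
    intro l
    induction l with
    | nil => intro _ h; simp at h
    | cons a l ih =>
      intro hl h
      rw [List.nodup_cons] at hl
      rw [List.foldr_cons, List.foldr_cons]
      by_cases ha : j = a
      · subst ha
        rw [notMem l hl.1]
        simp [Function.iterate_succ_apply']
      · have hj : j ∈ l := by simpa [ha] using h
        rw [ih hl.2 hj, pderiv_iterate_comm (contDiff_foldr_pderiv hf α l)]
        simp [Pi.single_eq_of_ne (Ne.symm ha)]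
  exact mem _ (List.nodup_finRange n) (List.mem_finRange j)

theorem degree_add_single (α : Fin n → ℕ) (j : Fin n) :
    degree (α + Pi.single j 1) = degree α + 1 := by
  simp [degree, Finset.sum_add_distrib]

theorem multiDeriv_zero_index (f : Euc n → ℝ) : multiDeriv 0 f = f := by
  unfold multiDeriv
  induction List.finRange n with
  | nil => rfl
  | cons a l ih => rw [List.foldr_cons, ih]; rfl

theorem multiDeriv_zero (α : Fin n → ℕ) : multiDeriv α (0 : Euc n → ℝ) = 0 := by
  unfold multiDeriv
  induction List.finRange n with
  | nil => rfl
  | cons a l ih =>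
    rw [List.foldr_cons, ih]
    induction α a with
    | zero => rfl
    | succ m ih => rw [Function.iterate_succ_apply, pderiv_zero, ih]

theorem multiDeriv_add {f g : Euc n → ℝ} (hf : ContDiff ℝ (⊤ : ℕ∞) f)
    (hg : ContDiff ℝ (⊤ : ℕ∞) g) (α : Fin n → ℕ) :
    multiDeriv α (f + g) = multiDeriv α f + multiDeriv α g := by
  unfold multiDeriv
  induction List.finRange n with
  | nil => rfl
  | cons a l ih =>
    rw [List.foldr_cons, List.foldr_cons, List.foldr_cons, ih]
    have hF := contDiff_foldr_pderiv hf α l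
    have hG := contDiff_foldr_pderiv hg α l
    induction α a with
    | zero => rfl
    | succ m ih =>
      rw [Function.iterate_succ_apply', Function.iterate_succ_apply', Function.iterate_succ_apply',
        ih, pderiv_add (contDiff_pderiv_iterate hF a m) (contDiff_pderiv_iterate hG a m)]

theorem pderiv_comp_homothety {f : Euc n → ℝ} (hf : ContDiff ℝ (⊤ : ℕ∞) f) (i : Fin n)
    (a c : ℝ) (x : Euc n) :
    pderiv i (fun y => a * f (c • (y - x))) = fun y => a * c * pderiv i f (c • (y - x)) := by
  ext y
  have h1 : HasFDerivAt (fun y : Euc n => c • (y - x)) (c • ContinuousLinearMap.id ℝ (Euc n)) y :=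
    ((hasFDerivAt_id y).sub_const x).const_smul c
  have h2 := (((hf.differentiable (by simp)) (c • (y - x))).hasFDerivAt.comp y h1).const_mul a
  simp only [pderiv]
  rw [show (fun y => a * f (c • (y - x))) =
    fun y => a * (f ∘ fun y : Euc n => c • (y - x)) y from rfl, h2.fderiv]
  simp
  ring

theorem multiDeriv_comp_homothety {f : Euc n → ℝ} (hf : ContDiff ℝ (⊤ : ℕ∞) f)
    (α : Fin n → ℕ) (c : ℝ) (x : Euc n) :
    multiDeriv α (fun y => f (c • (y - x))) =
      fun y => c ^ degree α * multiDeriv α f (c • (y - x)) := by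
  have iter : ∀ {g : Euc n → ℝ}, ContDiff ℝ (⊤ : ℕ∞) g → ∀ (i : Fin n) (m : ℕ) (a : ℝ),
      (pderiv i)^[m] (fun y => a * g (c • (y - x))) =
        fun y => a * c ^ m * (pderiv i)^[m] g (c • (y - x)) := by
    intro g hg i m a
    induction m with
    | zero => simp
    | succ m ih =>
      rw [Function.iterate_succ_apply', ih, Function.iterate_succ_apply',
        pderiv_comp_homothety (contDiff_pderiv_iterate hg i m)]
      ext y
      ring
  have fold : ∀ l : List (Fin n),
      l.foldr (fun i g => (pderiv i)^[α i] g) (fun y => f (c • (y - x))) =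
        fun y => c ^ (l.map α).sum *
          l.foldr (fun i g => (pderiv i)^[α i] g) f (c • (y - x)) := by
    intro l
    induction l with
    | nil => simp
    | cons a l ih =>
      rw [List.foldr_cons, List.foldr_cons, ih, iter (contDiff_foldr_pderiv hf α l)]
      ext y
      simp only [List.map_cons, List.sum_cons, pow_add]
      ring
  have hdeg : ((List.finRange n).map α).sum = degree α := by
    simp [degree, Fin.sum_univ_def]
  rw [← hdeg]
  exact fold _

/-! ### Kernels and the Euler operator -/

/-- Smooth functions vanishing off `S`. -/
def IsKernel (S : Set (Euc n)) (θ : Euc n → ℝ) : Prop :=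
  ContDiff ℝ (⊤ : ℕ∞) θ ∧ ∀ z ∉ S, θ z = 0

theorem IsKernel.tsupport_subset {S : Set (Euc n)} {θ : Euc n → ℝ} (hS : IsClosed S)
    (h : IsKernel S θ) : tsupport θ ⊆ S :=
  closure_minimal (fun z hz => by_contra fun hn => hz (h.2 z hn)) hS

theorem IsKernel.hasCompactSupport {S : Set (Euc n)} {θ : Euc n → ℝ} (hS : IsCompact S)
    (h : IsKernel S θ) : HasCompactSupport θ :=
  hS.of_isClosed_subset (isClosed_tsupport θ) (h.tsupport_subset hS.isClosed)

theorem IsKernel.fderiv_eq_zero {S : Set (Euc n)} {θ : Euc n → ℝ} (hS : IsClosed S)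
    (h : IsKernel S θ) {z : Euc n} (hz : z ∉ S) : fderiv ℝ θ z = 0 := by
  have h0 : θ =ᶠ[𝓝 z] fun _ => (0 : ℝ) := by
    filter_upwards [hS.isOpen_compl.mem_nhds hz] with y hy using h.2 y hy
  rw [h0.fderiv_eq]
  simp

theorem IsKernel.pderiv {S : Set (Euc n)} {θ : Euc n → ℝ} (hS : IsClosed S)
    (h : IsKernel S θ) (i : Fin n) : IsKernel S (pderiv i θ) :=
  ⟨contDiff_pderiv h.1 i, fun z hz => by
    change fderiv ℝ θ z _ = 0
    rw [h.fderiv_eq_zero hS hz]; rfl⟩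

theorem contDiff_coord (i : Fin n) : ContDiff ℝ (⊤ : ℕ∞) (fun z : Euc n => z i) :=
  (EuclideanSpace.proj (𝕜 := ℝ) i).contDiff

theorem IsKernel.coord_mul {S : Set (Euc n)} {θ : Euc n → ℝ}
    (h : IsKernel S θ) (i : Fin n) : IsKernel S (fun z => z i * θ z) :=
  ⟨(contDiff_coord i).mul h.1, fun z hz => by simp [h.2 z hz]⟩

/-- The shifted Euler operator `θ ↦ c θ + z · ∇θ`. -/
def euler (c : ℝ) (θ : Euc n → ℝ) : Euc n → ℝ := fun z => c * θ z + fderiv ℝ θ z z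

theorem IsKernel.euler {S : Set (Euc n)} {θ : Euc n → ℝ} (hS : IsClosed S)
    (h : IsKernel S θ) (c : ℝ) : IsKernel S (euler c θ) :=
  ⟨(contDiff_const.mul h.1).add
    ((h.1.fderiv_right (m := (⊤ : ℕ∞)) (by simp)).clm_apply contDiff_id), fun z hz => by
    simp [_root_.euler, h.2 z hz, h.fderiv_eq_zero hS hz]⟩

theorem euler_coord_mul {θ : Euc n → ℝ} (hθ : ContDiff ℝ (⊤ : ℕ∞) θ) (c : ℝ) (i : Fin n) :
    euler c (fun z => z i * θ z) = fun z => z i * euler (c + 1) θ z := by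
  ext z
  have h1 : HasFDerivAt (fun z : Euc n => z i) (EuclideanSpace.proj (𝕜 := ℝ) i) z :=
    (EuclideanSpace.proj (𝕜 := ℝ) i).hasFDerivAt
  have h2 := h1.mul ((hθ.differentiable (by simp)) z).hasFDerivAt
  simp only [euler]
  rw [show (fun z : Euc n => z i * θ z) = (fun z : Euc n => z i) * θ from rfl, h2.fderiv]
  simp
  ring

theorem pderiv_euler {θ : Euc n → ℝ} (hθ : ContDiff ℝ (⊤ : ℕ∞) θ) (c : ℝ) (i : Fin n) :
    pderiv i (euler c θ) = euler (c + 1) (pderiv i θ) := by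
  ext z
  have hc : ContDiff ℝ (⊤ : ℕ∞) (fderiv ℝ θ) := hθ.fderiv_right (m := (⊤ : ℕ∞)) (by simp)
  have hd : DifferentiableAt ℝ (fderiv ℝ θ) z := (hc.differentiable (by simp)) z
  have h1 := ((hθ.differentiable (by simp)) z).hasFDerivAt.const_mul c
  have h2 := hd.hasFDerivAt.clm_apply (hasFDerivAt_id z)
  have h3 : HasFDerivAt (euler c θ) _ z := h1.add h2
  have h4 := hd.hasFDerivAt.clm_apply
    (hasFDerivAt_const (EuclideanSpace.single i (1 : ℝ) : Euc n) z)
  have hs := (hθ.contDiffAt (x := z)).isSymmSndFDerivAt minSmoothness_two_le_smooth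
  have e1 : pderiv i θ = fun y => fderiv ℝ θ y (EuclideanSpace.single i 1) := rfl
  rw [pderiv, h3.fderiv, euler, e1, h4.fderiv]
  simp
  rw [hs.eq]
  ring

theorem euler_eq_sum_pderiv {θ : Euc n → ℝ} (hθ : ContDiff ℝ (⊤ : ℕ∞) θ) :
    euler n θ = ∑ i, pderiv i (fun z => z i * θ z) := by
  ext z
  rw [Finset.sum_apply]
  have h : ∀ i : Fin n, pderiv i (fun z => z i * θ z) z = θ z + z i * pderiv i θ z := by
    intro i
    have h1 : HasFDerivAt (fun z : Euc n => z i) (EuclideanSpace.proj (𝕜 := ℝ) i) z :=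
      (EuclideanSpace.proj (𝕜 := ℝ) i).hasFDerivAt
    have h2 := h1.mul ((hθ.differentiable (by simp)) z).hasFDerivAt
    rw [pderiv, show (fun z : Euc n => z i * θ z) = (fun z : Euc n => z i) * θ from rfl,
      h2.fderiv]
    simp [pderiv]
    ring
  simp only [h, Finset.sum_add_distrib]
  have hz : z = ∑ i, z i • EuclideanSpace.single i (1 : ℝ) := by
    ext j
    simp [Pi.single_apply]
  have : fderiv ℝ θ z z = ∑ i, z i * pderiv i θ z := by
    conv_lhs => rw [hz]
    rw [map_sum, ← hz]
    simp [pderiv]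
  rw [euler, this]
  simp

theorem IsKernel.integral_pderiv {S : Set (Euc n)} {θ : Euc n → ℝ} (hS : IsCompact S)
    (h : IsKernel S θ) (i : Fin n) : ∫ z, _root_.pderiv i θ z = 0 := by
  have hc : ∀ i, Integrable (_root_.pderiv i θ) := fun i =>
    (contDiff_pderiv h.1 i).continuous.integrable_of_hasCompactSupport
      ((h.pderiv hS.isClosed i).hasCompactSupport hS)
  have := integral_mul_fderiv_eq_neg_fderiv_mul_of_integrable (μ := (volume : Measure (Euc n)))
    (f := fun _ => (1 : ℝ)) (g := θ) (v := EuclideanSpace.single i (1 : ℝ)) (by simp)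
    (by simpa using! hc i)
    (by simpa using h.1.continuous.integrable_of_hasCompactSupport (h.hasCompactSupport hS))
    (by simp) (fun x _ => (h.1.differentiable (by simp)) x)
  simpa using! this

theorem IsKernel.integrable {S : Set (Euc n)} {θ : Euc n → ℝ} (hS : IsCompact S)
    (h : IsKernel S θ) : Integrable θ :=
  h.1.continuous.integrable_of_hasCompactSupport (h.hasCompactSupport hS)

theorem IsKernel.integral_euler {S : Set (Euc n)} {θ : Euc n → ℝ} (hS : IsCompact S)
    (h : IsKernel S θ) (c : ℝ) : ∫ z, _root_.euler (n + c) θ z = c * ∫ z, θ z := by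
  have e : ∀ z, _root_.euler (n + c) θ z =
      c * θ z + ∑ i, _root_.pderiv i (fun z => z i * θ z) z := by
    intro z
    rw [← Finset.sum_apply, ← euler_eq_sum_pderiv h.1]
    simp only [_root_.euler]
    ring
  simp only [e]
  have hi : ∀ i : Fin n, Integrable (_root_.pderiv i (fun z => z i * θ z)) := fun i =>
    ((h.coord_mul i).pderiv hS.isClosed i).integrable hS
  rw [integral_add ((h.integrable hS).const_mul c) (integrable_finsetSum _ fun i _ => hi i),
    integral_const_mul, integral_finsetSum _ fun i _ => hi i,
    Finset.sum_eq_zero fun i _ => (h.coord_mul i).integral_pderiv hS i, add_zero]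

/-- Finite sums of derivatives of order `k` of functions satisfying `Q`. -/
inductive DerivSum (Q : (Euc n → ℝ) → Prop) (k : ℕ) : (Euc n → ℝ) → Prop
  | base (α : Fin n → ℕ) (θ : Euc n → ℝ) (hα : degree α = k) (hθ : Q θ) :
      DerivSum Q k (multiDeriv α θ)
  | zero : DerivSum Q k 0
  | add (f g : Euc n → ℝ) (hf : DerivSum Q k f) (hg : DerivSum Q k g) : DerivSum Q k (f + g)

/-- Kernels on `S` of vanishing integral. -/
def IsMeanZeroKernel (S : Set (Euc n)) (θ : Euc n → ℝ) : Prop :=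
  IsKernel S θ ∧ ∫ z, θ z = 0

theorem IsKernel.isMeanZeroKernel_pderiv {S : Set (Euc n)} {θ : Euc n → ℝ} (hS : IsCompact S)
    (h : IsKernel S θ) (i : Fin n) : IsMeanZeroKernel S (_root_.pderiv i θ) :=
  ⟨h.pderiv hS.isClosed i, h.integral_pderiv hS i⟩

theorem DerivSum.sum {Q : (Euc n → ℝ) → Prop} {k : ℕ} {ι : Type*} (s : Finset ι)
    (f : ι → Euc n → ℝ) (h : ∀ i ∈ s, DerivSum Q k (f i)) : DerivSum Q k (∑ i ∈ s, f i) := by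
  classical
  induction s using Finset.induction_on with
  | empty => exact .zero
  | insert a s ha ih =>
    rw [Finset.sum_insert ha]
    exact .add _ _ (h a (Finset.mem_insert_self a s))
      (ih fun i hi => h i (Finset.mem_insert_of_mem hi))

theorem DerivSum.contDiff {Q : (Euc n → ℝ) → Prop} {k : ℕ}
    (hQ : ∀ θ, Q θ → ContDiff ℝ (⊤ : ℕ∞) θ) {f : Euc n → ℝ} (h : DerivSum Q k f) :
    ContDiff ℝ (⊤ : ℕ∞) f := by
  induction h with
  | base α θ hα hθ => exact contDiff_multiDeriv (hQ θ hθ) α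
  | zero => exact contDiff_const
  | add f g _ _ ihf ihg => exact ihf.add ihg

theorem DerivSum.pderiv_succ {Q : (Euc n → ℝ) → Prop} {k : ℕ}
    (hQ : ∀ θ, Q θ → ContDiff ℝ (⊤ : ℕ∞) θ) {f : Euc n → ℝ} (h : DerivSum Q k f) (i : Fin n) :
    DerivSum Q (k + 1) (pderiv i f) := by
  induction h with
  | base α θ hα hθ =>
    rw [← multiDeriv_add_single (hQ θ hθ)]
    exact .base _ _ (by rw [degree_add_single, hα]) hθ
  | zero => rw [pderiv_zero]; exact .zero
  | add f g hf hg ihf ihg =>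
    rw [pderiv_add (hf.contDiff hQ) (hg.contDiff hQ)]
    exact .add _ _ ihf ihg

theorem DerivSum.pderiv_of {Q Q' : (Euc n → ℝ) → Prop} {k : ℕ}
    (hQ : ∀ θ, Q θ → ContDiff ℝ (⊤ : ℕ∞) θ) (i : Fin n) (hQ' : ∀ θ, Q θ → Q' (pderiv i θ))
    {f : Euc n → ℝ} (h : DerivSum Q k f) : DerivSum Q' k (pderiv i f) := by
  induction h with
  | base α θ hα hθ =>
    rw [pderiv_multiDeriv (hQ θ hθ)]
    exact .base _ _ hα (hQ' θ hθ)
  | zero => rw [pderiv_zero]; exact .zero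
  | add f g hf hg ihf ihg =>
    rw [pderiv_add (hf.contDiff hQ) (hg.contDiff hQ)]
    exact .add _ _ ihf ihg

/-- The composition of the Euler operators with shifts `n + c, …, n + c + m - 1`. -/
def eulerProd : ℝ → ℕ → (Euc n → ℝ) → (Euc n → ℝ)
  | _, 0, θ => θ
  | c, m + 1, θ => euler (n + c) (eulerProd (c + 1) m θ)

theorem IsKernel.eulerProd {S : Set (Euc n)} (hS : IsClosed S) (m : ℕ) :
    ∀ (c : ℝ) {θ : Euc n → ℝ}, IsKernel S θ → IsKernel S (eulerProd c m θ) := by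
  induction m with
  | zero => exact fun c θ h => h
  | succ m ih => exact fun c θ h => (ih (c + 1) h).euler hS _

theorem eulerProd_coord_mul {S : Set (Euc n)} (hS : IsClosed S) (i : Fin n) (m : ℕ) :
    ∀ (c : ℝ) {θ : Euc n → ℝ}, IsKernel S θ →
      eulerProd c m (fun z => z i * θ z) = fun z => z i * eulerProd (c + 1) m θ z := by
  induction m with
  | zero => exact fun c θ h => rfl
  | succ m ih =>
    intro c θ h
    rw [eulerProd, ih (c + 1) h, euler_coord_mul (h.eulerProd hS m _).1, eulerProd]
    simp only [add_assoc]

theorem eulerProd_zero_succ {S : Set (Euc n)} (hS : IsClosed S) (m : ℕ) {θ : Euc n → ℝ}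
    (h : IsKernel S θ) :
    eulerProd 0 (m + 1) θ = ∑ i, pderiv i (eulerProd 0 m (fun z => z i * θ z)) := by
  rw [eulerProd, add_zero, euler_eq_sum_pderiv (h.eulerProd hS m _).1]
  refine Finset.sum_congr rfl fun i _ => ?_
  rw [eulerProd_coord_mul hS i m 0 h]

theorem derivSum_eulerProd {S : Set (Euc n)} (hS : IsClosed S) (m : ℕ) :
    ∀ {θ : Euc n → ℝ}, IsKernel S θ → DerivSum (IsKernel S) m (eulerProd 0 m θ) := by
  induction m with
  | zero =>
    intro θ h
    have := DerivSum.base (Q := IsKernel S) (k := 0) 0 θ (by simp [degree]) h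
    rwa [multiDeriv_zero_index] at this
  | succ m ih =>
    intro θ h
    rw [eulerProd_zero_succ hS m h]
    exact .sum _ _ fun i _ => (ih (h.coord_mul i)).pderiv_succ (fun _ h => h.1) i

theorem derivSum_meanZero_eulerProd {S : Set (Euc n)} (hS : IsCompact S) (m : ℕ)
    {θ : Euc n → ℝ} (h : IsKernel S θ) :
    DerivSum (IsMeanZeroKernel S) m (eulerProd 0 (m + 1) θ) := by
  rw [eulerProd_zero_succ hS.isClosed m h]
  exact .sum _ _ fun i _ => (derivSum_eulerProd hS.isClosed m (h.coord_mul i)).pderiv_of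
    (fun _ h => h.1) i fun _ h => h.isMeanZeroKernel_pderiv hS i

theorem integral_eulerProd {S : Set (Euc n)} (hS : IsCompact S) (m : ℕ) :
    ∀ c : ℝ, 0 < c → ∃ a : ℝ, 0 < a ∧ ∀ θ : Euc n → ℝ, IsKernel S θ →
      ∫ z, eulerProd c m θ z = a * ∫ z, θ z := by
  induction m with
  | zero => exact fun c _ => ⟨1, one_pos, fun θ _ => by rw [eulerProd, one_mul]⟩
  | succ m ih =>
    intro c hc
    obtain ⟨a, ha, h⟩ := ih (c + 1) (by linarith)
    refine ⟨c * a, mul_pos hc ha, fun θ hθ => ?_⟩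
    rw [eulerProd, (hθ.eulerProd hS.isClosed m _).integral_euler hS, h θ hθ, mul_assoc]

/-- A kernel of order `m` is one whose scaling derivative is a finite sum of derivatives of
order `k` of kernels of vanishing integral. -/
structure IsGoodKernel (S : Set (Euc n)) (k m : ℕ) (Φ : Euc n → ℝ) : Prop where
  isKernel : IsKernel S Φ
  euler : DerivSum (IsMeanZeroKernel S) k (euler (n + m) Φ)

theorem IsGoodKernel.pderiv {S : Set (Euc n)} (hS : IsCompact S) {k m : ℕ} {Φ : Euc n → ℝ}
    (h : IsGoodKernel S k m Φ) (i : Fin n) : IsGoodKernel S k (m + 1) (pderiv i Φ) := by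
  refine ⟨h.isKernel.pderiv hS.isClosed i, ?_⟩
  have e : _root_.euler (n + (m + 1 : ℕ)) (_root_.pderiv i Φ) =
      _root_.pderiv i (_root_.euler (n + m) Φ) := by
    rw [pderiv_euler h.isKernel.1]
    push_cast
    rw [add_assoc]
  rw [e]
  exact h.euler.pderiv_of (fun _ h => h.1.1) i fun _ h => h.1.isMeanZeroKernel_pderiv hS i

theorem exists_isGoodKernel {S : Set (Euc n)} (hS : IsCompact S) (k : ℕ) {z₀ : Euc n} {r : ℝ}
    (hr : 0 < r) (hz : closedBall z₀ r ⊆ S) :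
    ∃ Ψ : Euc n → ℝ, IsGoodKernel S k 0 Ψ ∧ ∫ z, Ψ z = 1 := by
  let b : ContDiffBump z₀ := ⟨r / 2, r, by positivity, by linarith⟩
  obtain ⟨a, ha, h⟩ := integral_eulerProd hS k 1 one_pos
  have hb : IsKernel S (fun z => a⁻¹ * b.normed volume z) := by
    refine ⟨contDiff_const.mul b.contDiff_normed, fun z hzS => ?_⟩
    have : b.normed volume z = 0 := by
      rw [← Function.notMem_support, b.support_normed_eq]
      exact fun hz' => hzS (hz (ball_subset_closedBall hz'))
    simp only [this, mul_zero]
  refine ⟨eulerProd 1 k _, ⟨hb.eulerProd hS.isClosed k _, ?_⟩, ?_⟩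
  · have := derivSum_meanZero_eulerProd hS k hb
    rw [eulerProd] at this
    simpa using this
  · rw [h _ hb, integral_const_mul, b.integral_normed, mul_one, mul_inv_cancel₀ ha.ne']

theorem IsKernel.multiDeriv {S : Set (Euc n)} {θ : Euc n → ℝ} (hS : IsClosed S)
    (h : IsKernel S θ) (α : Fin n → ℕ) : IsKernel S (multiDeriv α θ) := by
  unfold _root_.multiDeriv
  induction List.finRange n with
  | nil => exact h
  | cons a l ih =>
    rw [List.foldr_cons]
    induction α a with
    | zero => exact ih
    | succ m ihm => rw [Function.iterate_succ_apply']; exact ihm.pderiv hS a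

theorem DerivSum.isKernel {S : Set (Euc n)} (hS : IsClosed S) {k : ℕ} {f : Euc n → ℝ}
    (h : DerivSum (IsMeanZeroKernel S) k f) : IsKernel S f := by
  induction h with
  | base α θ _ hθ => exact hθ.1.multiDeriv hS α
  | zero => exact ⟨contDiff_const, fun _ _ => rfl⟩
  | add f g _ _ ihf ihg =>
    exact ⟨ihf.1.add ihg.1, fun z hz => by simp [ihf.2 z hz, ihg.2 z hz]⟩

/-! ### Averages against rescaled kernels -/

/-- The average `ε ^ (-(n + m)) ∫ u y Θ((y - x) / ε) dy`. -/
def avg (u : Euc n → ℝ) (m : ℕ) (Θ : Euc n → ℝ) (ε : ℝ) (x : Euc n) : ℝ :=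
  (ε ^ (n + m))⁻¹ * ∫ y, u y * Θ (ε⁻¹ • (y - x))

theorem IsKernel.exists_bound {S : Set (Euc n)} (hS : IsCompact S) {Θ : Euc n → ℝ}
    (h : IsKernel S Θ) : ∃ M : ℝ, 0 ≤ M ∧ ∀ z, |Θ z| ≤ M := by
  obtain ⟨M, hM⟩ := (h.hasCompactSupport hS).exists_bound_of_continuous h.1.continuous
  exact ⟨M, (norm_nonneg _).trans (hM 0), hM⟩

theorem IsKernel.integrable_mul {S : Set (Euc n)} (hS : IsCompact S) {Θ : Euc n → ℝ}
    (h : IsKernel S Θ) {u : Euc n → ℝ} (hu : Integrable u) (c : ℝ) (x : Euc n) :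
    Integrable fun y => u y * Θ (c • (y - x)) := by
  obtain ⟨M, -, hM⟩ := h.exists_bound hS
  have hc : Continuous fun y => Θ (c • (y - x)) := h.1.continuous.comp (by fun_prop)
  exact hu.mul_bdd hc.aestronglyMeasurable (Eventually.of_forall fun y => hM _)

theorem avg_add {S : Set (Euc n)} (hS : IsCompact S) {f g : Euc n → ℝ}
    (hf : IsKernel S f) (hg : IsKernel S g) {u : Euc n → ℝ} (hu : Integrable u) (m : ℕ) (ε : ℝ)
    (x : Euc n) : avg u m (f + g) ε x = avg u m f ε x + avg u m g ε x := by
  unfold avg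
  simp only [Pi.add_apply, mul_add]
  rw [integral_add (hf.integrable_mul hS hu _ _) (hg.integrable_mul hS hu _ _), mul_add]

theorem IsKernel.exists_avg_bound {S : Set (Euc n)} (hS : IsCompact S) {Θ : Euc n → ℝ}
    (h : IsKernel S Θ) {u : Euc n → ℝ} (hu : Integrable u) (m : ℕ) :
    ∃ M : ℝ, 0 ≤ M ∧ ∀ ε : ℝ, 0 < ε → ∀ x, |avg u m Θ ε x| ≤ (ε ^ (n + m))⁻¹ * M := by
  obtain ⟨M, hM0, hM⟩ := h.exists_bound hS
  refine ⟨∫ y, |u y| * M, integral_nonneg fun y => by positivity, fun ε hε x => ?_⟩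
  unfold avg
  rw [abs_mul, abs_of_pos (by positivity : 0 < (ε ^ (n + m))⁻¹)]
  gcongr
  refine (norm_integral_le_integral_norm _).trans (integral_mono_of_nonneg
    (Eventually.of_forall fun y => norm_nonneg (u y * Θ (ε⁻¹ • (y - x)))) (hu.abs.mul_const M)
    (Eventually.of_forall fun y => ?_))
  simp only [norm_mul, Real.norm_eq_abs]
  gcongr
  exact hM _

theorem IsKernel.hasDerivAt_avg {S : Set (Euc n)} (hS : IsCompact S) {Θ : Euc n → ℝ}
    (h : IsKernel S Θ) {u : Euc n → ℝ} (hu : Integrable u) (m : ℕ) {ε : ℝ} (hε : 0 < ε)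
    (x : Euc n) :
    HasDerivAt (fun e => avg u m Θ e x) (-avg u (m + 1) (_root_.euler (n + m) Θ) ε x) ε := by
  have hE := h.euler hS.isClosed 0
  obtain ⟨M, hM0, hM⟩ := hE.exists_bound hS
  have hd : ∀ e : ℝ, 0 < e → ∀ y : Euc n, HasDerivAt (fun e : ℝ => u y * Θ (e⁻¹ • (y - x)))
      (u y * (-e⁻¹ * _root_.euler 0 Θ (e⁻¹ • (y - x)))) e := by
    intro e he y
    have h1 : HasDerivAt (fun e : ℝ => e⁻¹ • (y - x)) ((-(e ^ 2)⁻¹) • (y - x)) e :=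
      (hasDerivAt_inv he.ne').smul_const (y - x)
    have h2 := (((h.1.differentiable (by simp)) (e⁻¹ • (y - x))).hasFDerivAt.comp_hasDerivAt e
      h1).const_mul (u y)
    refine h2.congr_deriv ?_
    simp only [_root_.euler, map_smul, smul_eq_mul]
    field_simp
    ring
  have key := hasDerivAt_integral_of_dominated_loc_of_deriv_le (μ := (volume : Measure (Euc n)))
    (F := fun (e : ℝ) y => u y * Θ (e⁻¹ • (y - x)))
    (F' := fun (e : ℝ) y => u y * (-e⁻¹ * _root_.euler 0 Θ (e⁻¹ • (y - x))))
    (bound := fun y => |u y| * ((ε / 2)⁻¹ * M))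
    (Ioi_mem_nhds (half_lt_self hε))
    (Eventually.of_forall fun e => (h.integrable_mul hS hu _ _).aestronglyMeasurable)
    (h.integrable_mul hS hu _ _)
    (((hE.integrable_mul hS hu ε⁻¹ x).const_mul (-ε⁻¹)).congr
      (Eventually.of_forall fun y => by ring)).aestronglyMeasurable
    (Eventually.of_forall fun y e he => by
      have he' : ε / 2 < e := he
      have he0 : 0 < e := (half_pos hε).trans he'
      rw [norm_mul, Real.norm_eq_abs, norm_mul, norm_neg, Real.norm_eq_abs, Real.norm_eq_abs,
        abs_of_pos (inv_pos.2 he0)]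
      gcongr
      exact hM _)
    (hu.abs.mul_const _)
    (Eventually.of_forall fun y e he => hd e ((half_pos hε).trans he) y)
  have hpow : HasDerivAt (fun e : ℝ => (e ^ (n + m))⁻¹) (-((n + m : ℕ) * (ε ^ (n + m + 1))⁻¹)) ε := by
    have h1 := (hasDerivAt_pow (n + m) ε).inv (pow_ne_zero _ hε.ne')
    refine HasDerivAt.congr_deriv h1 ?_
    rcases Nat.eq_zero_or_pos (n + m) with h0 | h0
    · simp [h0]
    · obtain ⟨q, hq⟩ := Nat.exists_eq_succ_of_ne_zero h0.ne'
      rw [hq]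
      simp only [Nat.succ_eq_add_one, Nat.add_sub_cancel]
      field_simp
      ring
  have hmul := hpow.mul key.2
  refine hmul.congr_deriv ?_
  unfold avg
  have e1 : ∀ y, u y * _root_.euler (n + m) Θ (ε⁻¹ • (y - x)) =
      (n + m) * (u y * Θ (ε⁻¹ • (y - x))) + u y * _root_.euler 0 Θ (ε⁻¹ • (y - x)) := by
    intro y
    simp only [_root_.euler]
    ring
  have e2 : ∀ y, u y * (-ε⁻¹ * _root_.euler 0 Θ (ε⁻¹ • (y - x))) =
      -ε⁻¹ * (u y * _root_.euler 0 Θ (ε⁻¹ • (y - x))) := fun y => by ring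
  simp only [e1, e2]
  rw [integral_add ((h.integrable_mul hS hu _ _).const_mul _) (hE.integrable_mul hS hu _ _),
    integral_const_mul, integral_const_mul]
  push_cast
  rw [← add_assoc, pow_succ]
  field_simp
  ring

theorem fderiv_eq_sum_pderiv (f : Euc n → ℝ) (x : Euc n) :
    fderiv ℝ f x = ∑ i, pderiv i f x • EuclideanSpace.proj (𝕜 := ℝ) i := by
  ext v
  have hv : v = ∑ i, v i • EuclideanSpace.single i (1 : ℝ) := by
    ext j
    simp [Pi.single_apply]
  conv_lhs => rw [hv]
  rw [map_sum]
  simp [pderiv, mul_comm]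

theorem IsKernel.hasFDerivAt_avg {S : Set (Euc n)} (hS : IsCompact S) {Θ : Euc n → ℝ}
    (h : IsKernel S Θ) {u : Euc n → ℝ} (hu : Integrable u) (m : ℕ) {ε : ℝ} (hε : 0 < ε)
    (x : Euc n) :
    HasFDerivAt (avg u m Θ ε)
      (∑ i, (-avg u (m + 1) (_root_.pderiv i Θ) ε x) • EuclideanSpace.proj (𝕜 := ℝ) i) x := by
  have hP := fun i => h.pderiv hS.isClosed i
  obtain ⟨M, hM⟩ := ((h.hasCompactSupport hS).fderiv (𝕜 := ℝ)).exists_bound_of_continuous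
    (h.1.continuous_fderiv (by simp))
  have hM0 : 0 ≤ M := (norm_nonneg _).trans (hM 0)
  have hd : ∀ x y : Euc n, HasFDerivAt (fun x : Euc n => u y * Θ (ε⁻¹ • (y - x)))
      (u y • (-ε⁻¹) • fderiv ℝ Θ (ε⁻¹ • (y - x))) x := by
    intro x y
    have h1 : HasFDerivAt (fun x : Euc n => ε⁻¹ • (y - x))
        (ε⁻¹ • -ContinuousLinearMap.id ℝ (Euc n)) x :=
      ((hasFDerivAt_id x).const_sub y).const_smul ε⁻¹
    have h2 := (((h.1.differentiable (by simp)) (ε⁻¹ • (y - x))).hasFDerivAt.comp x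
      h1).const_mul (u y)
    refine h2.congr_fderiv ?_
    ext v
    simp
  have hcf : Continuous fun y => fderiv ℝ Θ (ε⁻¹ • (y - x)) :=
    (h.1.continuous_fderiv (by simp)).comp (by fun_prop)
  have key := hasFDerivAt_integral_of_dominated_of_fderiv_le (μ := (volume : Measure (Euc n)))
    (F := fun (x : Euc n) y => u y * Θ (ε⁻¹ • (y - x)))
    (F' := fun (x : Euc n) y => u y • (-ε⁻¹) • fderiv ℝ Θ (ε⁻¹ • (y - x)))
    (bound := fun y => |u y| * (ε⁻¹ * M)) (x₀ := x) univ_mem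
    (Eventually.of_forall fun e => (h.integrable_mul hS hu _ _).aestronglyMeasurable)
    (h.integrable_mul hS hu _ _)
    (hu.aestronglyMeasurable.smul (hcf.const_smul (-ε⁻¹)).aestronglyMeasurable)
    (Eventually.of_forall fun y e _ => by
      rw [norm_smul, norm_smul, norm_neg, Real.norm_eq_abs, Real.norm_eq_abs,
        abs_of_pos (inv_pos.2 hε)]
      gcongr
      exact hM _)
    (hu.abs.mul_const _)
    (Eventually.of_forall fun y e _ => hd e y)
  have hmul := key.const_mul ((ε ^ (n + m))⁻¹)
  refine hmul.congr_fderiv ?_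
  have e1 : ∀ y, u y • (-ε⁻¹) • fderiv ℝ Θ (ε⁻¹ • (y - x)) =
      ∑ i, (-ε⁻¹ * (u y * _root_.pderiv i Θ (ε⁻¹ • (y - x)))) •
        EuclideanSpace.proj (𝕜 := ℝ) i := by
    intro y
    rw [fderiv_eq_sum_pderiv, Finset.smul_sum, Finset.smul_sum]
    refine Finset.sum_congr rfl fun i _ => ?_
    rw [smul_smul, smul_smul]
    congr 1
    ring
  simp only [e1]
  rw [integral_finsetSum _ fun i _ =>
    ((((hP i).integrable_mul hS hu ε⁻¹ x).const_mul (-ε⁻¹)).smul_const _), Finset.smul_sum]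
  refine Finset.sum_congr rfl fun i _ => ?_
  rw [integral_smul_const, integral_const_mul, smul_smul]
  congr 1
  unfold avg
  rw [← add_assoc, pow_succ]
  field_simp

/-! ### Oscillation estimates for averages -/

/-- The Slobodeckij quotient of `w` with smoothness `σ` and exponent `p`. -/
def slobodeckij (σ p : ℝ) (w : Euc n → ℝ) (q : Euc n × Euc n) : ℝ :=
  |w q.1 - w q.2| ^ p / ‖q.1 - q.2‖ ^ ((n : ℝ) + σ * p)

theorem slobodeckij_nonneg (σ p : ℝ) (w : Euc n → ℝ) (q : Euc n × Euc n) :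
    0 ≤ slobodeckij σ p w q := by
  unfold slobodeckij
  positivity

theorem le_add_rpow_mul_rpow {a t p : ℝ} (ha : 0 ≤ a) (ht : 0 < t) (hp : 1 < p) :
    a ≤ t + t ^ (1 - p) * a ^ p := by
  rcases le_total a t with h | h
  · have : 0 ≤ t ^ (1 - p) * a ^ p := by positivity
    linarith
  · have ha' : 0 < a := ht.trans_le h
    have h1 : a ^ (1 - p) ≤ t ^ (1 - p) := Real.rpow_le_rpow_of_nonpos ht h (by linarith)
    have h2 : a ^ (1 - p) * a ^ p = a := by
      rw [← Real.rpow_add ha']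
      simp
    calc a = a ^ (1 - p) * a ^ p := h2.symm
      _ ≤ t ^ (1 - p) * a ^ p := by gcongr
      _ ≤ _ := by linarith

theorem rpow_abs_sub_le {σ p d : ℝ} (hσ : 0 ≤ σ) (hp : 1 < p) (w : Euc n → ℝ)
    (q : Euc n × Euc n) (hq : ‖q.1 - q.2‖ ≤ d) :
    |w q.1 - w q.2| ^ p ≤ d ^ ((n : ℝ) + σ * p) * slobodeckij σ p w q := by
  have hd : 0 ≤ d := (norm_nonneg _).trans hq
  by_cases h : q.1 = q.2
  · rw [h, sub_self, abs_zero, Real.zero_rpow (by linarith)]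
    exact mul_nonneg (Real.rpow_nonneg hd _) (slobodeckij_nonneg _ _ _ _)
  · have h0 : 0 < ‖q.1 - q.2‖ := norm_pos_iff.2 (sub_ne_zero.2 h)
    unfold slobodeckij
    rw [← mul_div_assoc, le_div_iff₀ (Real.rpow_pos_of_pos h0 _), mul_comm]
    gcongr

theorem measureReal_mul_abs_integral_le {D B : Set (Euc n)} (hBD : B ⊆ D) (hB : IsCompact B)
    {σ p d t M : ℝ} (hσ : 0 ≤ σ) (hp : 1 < p) (ht : 0 < t) (hM : 0 ≤ M)
    (hd0 : 0 ≤ d) (hd : ∀ y ∈ B, ∀ y' ∈ B, ‖y - y'‖ ≤ d) {w φ : Euc n → ℝ} (hw : IntegrableOn w B)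
    (hW : IntegrableOn (slobodeckij σ p w) (D ×ˢ D)) (hφc : Continuous φ)
    (hφM : ∀ y, |φ y| ≤ M) (hφB : ∀ y ∉ B, φ y = 0) (hφ0 : ∫ y, φ y = 0) :
    volume.real B * |∫ y in B, w y * φ y| ≤
      M * (t * volume.real B ^ 2 +
        t ^ (1 - p) * d ^ ((n : ℝ) + σ * p) * ∫ q in D ×ˢ D, slobodeckij σ p w q) := by
  have hfin : volume B ≠ ⊤ := hB.measure_lt_top.ne
  have : IsFiniteMeasure (volume.restrict B) := ⟨by simpa using hB.measure_lt_top⟩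
  have hres : (volume.restrict B).prod (volume.restrict B) =
      (volume : Measure (Euc n × Euc n)).restrict (B ×ˢ B) := by
    rw [Measure.prod_restrict, Measure.volume_eq_prod]
  have hφi : IntegrableOn φ B := hφc.continuousOn.integrableOn_compact hB
  have hwφ : IntegrableOn (fun y => w y * φ y) B :=
    Integrable.mul_bdd hw hφc.aestronglyMeasurable (Eventually.of_forall hφM)
  have hφ0' : ∫ y in B, φ y = 0 := by
    rw [setIntegral_eq_integral_of_forall_compl_eq_zero hφB, hφ0]
  have i1 : Integrable (fun q : Euc n × Euc n => w q.1 * φ q.1)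
      ((volume.restrict B).prod (volume.restrict B)) :=
    (hwφ.mul_prod (integrable_const (1 : ℝ))).congr (Eventually.of_forall fun q => by simp)
  have i2 : Integrable (fun q : Euc n × Euc n => φ q.1 * w q.2)
      ((volume.restrict B).prod (volume.restrict B)) := hφi.mul_prod hw
  have hident : ∫ q in B ×ˢ B, (w q.1 - w q.2) * φ q.1 =
      volume.real B * ∫ y in B, w y * φ y := by
    have e : ∀ q : Euc n × Euc n, (w q.1 - w q.2) * φ q.1 = w q.1 * φ q.1 - φ q.1 * w q.2 :=
      fun q => by ring
    simp only [e]
    rw [← hres, integral_sub i1 i2, integral_prod_mul, hφ0', zero_mul, sub_zero]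
    have := integral_prod_mul (μ := volume.restrict B) (ν := volume.restrict B)
      (fun y => w y * φ y) (fun _ : Euc n => (1 : ℝ))
    simp only [mul_one] at this
    rw [this]
    simp [mul_comm]
  have hBB : MeasurableSet (B ×ˢ B) := hB.measurableSet.prod hB.measurableSet
  have hWB : IntegrableOn (slobodeckij σ p w) (B ×ˢ B) := hW.mono_set (prod_mono hBD hBD)
  have hconst : IntegrableOn (fun _ : Euc n × Euc n => t) (B ×ˢ B) := by
    rw [IntegrableOn, ← hres]
    exact integrable_const t
  have hbound : |∫ q in B ×ˢ B, (w q.1 - w q.2) * φ q.1| ≤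
      ∫ q in B ×ˢ B, M * (t + t ^ (1 - p) * d ^ ((n : ℝ) + σ * p) * slobodeckij σ p w q) := by
    have hint : IntegrableOn (fun q => M * (t + t ^ (1 - p) * d ^ ((n : ℝ) + σ * p) *
        slobodeckij σ p w q)) (B ×ˢ B) := (hconst.add (hWB.const_mul _)).const_mul M
    rw [← Real.norm_eq_abs]
    refine norm_integral_le_of_norm_le hint ?_
    refine (ae_restrict_iff' hBB).2 (Eventually.of_forall fun q hq => ?_)
    rw [norm_mul, Real.norm_eq_abs, Real.norm_eq_abs, mul_comm]
    have h1 := le_add_rpow_mul_rpow (abs_nonneg (w q.1 - w q.2)) ht hp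
    have h2 := rpow_abs_sub_le hσ hp w q (hd _ hq.1 _ hq.2)
    refine mul_le_mul (hφM _) (h1.trans ?_) (abs_nonneg _) hM
    rw [mul_assoc]
    gcongr
  rw [hident, abs_mul, abs_of_nonneg measureReal_nonneg] at hbound
  refine hbound.trans ?_
  rw [integral_const_mul, integral_add hconst (hWB.const_mul _), integral_const_mul]
  have hle : ∫ q in B ×ˢ B, slobodeckij σ p w q ≤ ∫ q in D ×ˢ D, slobodeckij σ p w q :=
    setIntegral_mono_set hW (Eventually.of_forall fun q => slobodeckij_nonneg _ _ _ _)
      (prod_mono hBD hBD).eventuallyLE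
  have hc : ∫ q in B ×ˢ B, t = t * volume.real B ^ 2 := by
    rw [setIntegral_const, Measure.volume_eq_prod, measureReal_def, Measure.prod_prod,
      ENNReal.toReal_mul, smul_eq_mul, measureReal_def]
    ring
  rw [hc]
  gcongr

/-- The analytic hypotheses on `u`: it is integrable on `D` and its weak derivatives of order `k`
have integrable Slobodeckij quotients. -/
structure IsSlobodeckij (D : Set (Euc n)) (k : ℕ) (σ p : ℝ) (u : Euc n → ℝ)
    (g : (Fin n → ℕ) → Euc n → ℝ) : Prop where
  integrableOn : IntegrableOn u D
  isWeakDeriv : ∀ α, degree α = k → IsWeakDeriv D α u (g α)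
  locallyIntegrableOn : ∀ α, degree α = k → LocallyIntegrableOn (g α) D
  integrableOn_slobodeckij : ∀ α, degree α = k →
    IntegrableOn (slobodeckij σ p (g α)) (D ×ˢ D)

theorem integral_comp_homothety {θ : Euc n → ℝ} (hθ : ∫ z, θ z = 0) (c : ℝ) (x : Euc n) :
    ∫ y, θ (c • (y - x)) = 0 := by
  rw [integral_sub_right_eq_self (fun y => θ (c • y)) x, Measure.integral_comp_smul, hθ,
    smul_zero]

theorem exists_avg_multiDeriv_bound {D : Set (Euc n)} (hD : IsOpen D) {k : ℕ} {σ p : ℝ}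
    (hσ : 0 ≤ σ) (hp : 1 < p) {u : Euc n → ℝ} {g : (Fin n → ℕ) → Euc n → ℝ}
    (hu : IsSlobodeckij D k σ p u g) {z₀ : Euc n} {r : ℝ} (hr : 0 < r) (α : Fin n → ℕ)
    (hα : degree α = k) {θ : Euc n → ℝ} (hθ : IsMeanZeroKernel (closedBall z₀ r) θ) (m : ℕ) :
    ∃ C : ℝ, 0 ≤ C ∧ ∀ ε : ℝ, 0 < ε → ∀ x, closedBall (x + ε • z₀) (ε * r) ⊆ D →
      |avg (D.indicator u) m (multiDeriv α θ) ε x| ≤ C * ε ^ (k + σ - n / p - m) := by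
  have hS : IsCompact (closedBall z₀ r) := isCompact_closedBall z₀ r
  obtain ⟨M, hM0, hM⟩ := hθ.1.exists_bound hS
  set I := ∫ q in D ×ˢ D, slobodeckij σ p (g α) q with hI
  have hI0 : 0 ≤ I := integral_nonneg fun q => slobodeckij_nonneg _ _ _ _
  set c := volume.real (ball (0 : Euc n) 1) * r ^ n with hc
  have hc0 : 0 < c := by
    have : 0 < volume.real (ball (0 : Euc n) 1) :=
      ENNReal.toReal_pos (measure_ball_pos _ _ one_pos).ne' measure_ball_lt_top.ne
    positivity
  refine ⟨c⁻¹ * (M * (c ^ 2 + (2 * r) ^ ((n : ℝ) + σ * p) * I)), by positivity,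
    fun ε hε x hB => ?_⟩
  set B := closedBall (x + ε • z₀) (ε * r) with hBdef
  set φ : Euc n → ℝ := fun y => θ (ε⁻¹ • (y - x)) with hφ
  have hφs : ContDiff ℝ (⊤ : ℕ∞) φ := hθ.1.1.comp (by fun_prop)
  have hφB : ∀ y ∉ B, φ y = 0 := by
    intro y hy
    refine hθ.1.2 _ fun hz => hy ?_
    rw [mem_closedBall, dist_eq_norm] at hz ⊢
    have e : y - (x + ε • z₀) = ε • (ε⁻¹ • (y - x) - z₀) := by
      rw [smul_sub, smul_inv_smul₀ hε.ne']
      abel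
    rw [e, norm_smul, Real.norm_eq_abs, abs_of_pos hε]
    gcongr
  have hBc : IsCompact B := isCompact_closedBall _ _
  have hφk : IsKernel B φ := ⟨hφs, hφB⟩
  have hweak := hu.isWeakDeriv α hα φ hφs (hφk.hasCompactSupport hBc)
    ((hφk.tsupport_subset hBc.isClosed).trans hB)
  have hgB : IntegrableOn (g α) B :=
    (hu.locallyIntegrableOn α hα).integrableOn_compact_subset hB hBc
  have hvol : volume.real B = c * ε ^ n := by
    rw [measureReal_def, hBdef, Measure.addHaar_closedBall _ _ (by positivity), ENNReal.toReal_mul,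
      ENNReal.toReal_ofReal (by positivity), hc, measureReal_def, finrank_euclideanSpace_fin]
    ring
  have hdiam : ∀ y ∈ B, ∀ y' ∈ B, ‖y - y'‖ ≤ 2 * r * ε := by
    intro y hy y' hy'
    rw [← dist_eq_norm]
    have h1 := dist_triangle_right y y' (x + ε • z₀)
    rw [hBdef, mem_closedBall] at hy hy'
    linarith
  have hosc := measureReal_mul_abs_integral_le hB hBc hσ hp
    (Real.rpow_pos_of_pos hε (σ - n / p)) hM0 (by positivity) hdiam hgB
    (hu.integrableOn_slobodeckij α hα) hφs.continuous (fun y => hM _) hφB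
    (integral_comp_homothety hθ.2 _ _)
  have hDB : ∫ y in D, g α y * φ y = ∫ y in B, g α y * φ y :=
    (setIntegral_eq_of_subset_of_forall_sdiff_eq_zero hD.measurableSet hB
      fun y hy => by rw [hφB y hy.2, mul_zero])
  have havg : avg (D.indicator u) m (multiDeriv α θ) ε x =
      (ε ^ (n + m))⁻¹ * (ε ^ k * ((-1) ^ k * ∫ y in B, g α y * φ y)) := by
    rw [← hDB, ← hα, ← hweak, hφ, multiDeriv_comp_homothety hθ.1.1, avg]
    congr 1
    rw [← integral_const_mul, ← integral_indicator hD.measurableSet]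
    refine integral_congr_ae (Eventually.of_forall fun y => ?_)
    by_cases hy : y ∈ D
    · simp only [Set.indicator_of_mem hy]
      rw [inv_pow]
      field_simp
    · simp only [Set.indicator_of_notMem hy, zero_mul]
  rw [hvol, ← hI] at hosc
  have hosc' : |∫ y in B, g α y * φ y| ≤ (c * ε ^ n)⁻¹ * (M * (ε ^ (σ - n / p) * (c * ε ^ n) ^ 2 +
      (ε ^ (σ - n / p)) ^ (1 - p) * (2 * r * ε) ^ ((n : ℝ) + σ * p) * I)) := by
    rw [inv_mul_eq_div, le_div_iff₀ (by positivity), mul_comm]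
    exact hosc
  have hpow : (ε ^ (σ - n / p)) ^ (1 - p) * (2 * r * ε) ^ ((n : ℝ) + σ * p) =
      ε ^ (σ - n / p) * (ε ^ n) ^ 2 * (2 * r) ^ ((n : ℝ) + σ * p) := by
    rw [Real.mul_rpow (by positivity) hε.le, ← Real.rpow_mul hε.le]
    have : ε ^ ((σ - n / p) * (1 - p)) * ε ^ ((n : ℝ) + σ * p) =
        ε ^ (σ - n / p) * (ε ^ n) ^ 2 := by
      rw [← Real.rpow_natCast ε n, ← Real.rpow_natCast (ε ^ (n : ℝ)) 2, ← Real.rpow_mul hε.le,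
        ← Real.rpow_add hε, ← Real.rpow_add hε]
      congr 1
      push_cast
      field_simp
      ring
    rw [← this]
    ring
  have hexp : ε ^ (k + σ - n / p - m) = (ε ^ m)⁻¹ * ε ^ k * ε ^ (σ - n / p) := by
    rw [← Real.rpow_natCast ε m, ← Real.rpow_natCast ε k, ← Real.rpow_neg hε.le,
      ← Real.rpow_add hε, ← Real.rpow_add hε]
    congr 1
    ring
  rw [havg, abs_mul, abs_mul, abs_mul, abs_of_pos (by positivity : 0 < (ε ^ (n + m))⁻¹),
    abs_of_pos (by positivity : 0 < ε ^ k), abs_pow, abs_neg, abs_one, one_pow, one_mul]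
  calc _ ≤ (ε ^ (n + m))⁻¹ * (ε ^ k * ((c * ε ^ n)⁻¹ * (M * (ε ^ (σ - n / p) * (c * ε ^ n) ^ 2 +
      (ε ^ (σ - n / p)) ^ (1 - p) * (2 * r * ε) ^ ((n : ℝ) + σ * p) * I)))) := by gcongr
    _ = _ := by
      rw [hpow, hexp, pow_add]
      field_simp

theorem exists_avg_bound_of_derivSum {D : Set (Euc n)} (hD : IsOpen D) {k : ℕ} {σ p : ℝ}
    (hσ : 0 ≤ σ) (hp : 1 < p) {u : Euc n → ℝ} {g : (Fin n → ℕ) → Euc n → ℝ}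
    (hu : IsSlobodeckij D k σ p u g) {z₀ : Euc n} {r : ℝ} (hr : 0 < r) {Θ : Euc n → ℝ}
    (hΘ : DerivSum (IsMeanZeroKernel (closedBall z₀ r)) k Θ) (m : ℕ) :
    ∃ C : ℝ, 0 ≤ C ∧ ∀ ε : ℝ, 0 < ε → ∀ x, closedBall (x + ε • z₀) (ε * r) ⊆ D →
      |avg (D.indicator u) m Θ ε x| ≤ C * ε ^ (k + σ - n / p - m) := by
  have hS : IsCompact (closedBall z₀ r) := isCompact_closedBall z₀ r
  have hui : Integrable (D.indicator u) := hu.integrableOn.integrable_indicator hD.measurableSet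
  induction hΘ with
  | base α θ hα hθ => exact exists_avg_multiDeriv_bound hD hσ hp hu hr α hα hθ m
  | zero =>
    refine ⟨0, le_rfl, fun ε hε x _ => ?_⟩
    simp [avg]
  | add f h hf hh ihf ihh =>
    obtain ⟨C₁, h₁, hC₁⟩ := ihf
    obtain ⟨C₂, h₂, hC₂⟩ := ihh
    refine ⟨C₁ + C₂, add_nonneg h₁ h₂, fun ε hε x hx => ?_⟩
    rw [avg_add hS (hf.isKernel hS.isClosed) (hh.isKernel hS.isClosed) hui, add_mul]
    exact (abs_add_le _ _).trans (add_le_add (hC₁ ε hε x hx) (hC₂ ε hε x hx))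

/-! ### Limits of averages -/

/-- The averages of `w` against sums of `k`-th order derivatives of mean zero kernels supported in
`closedBall z₀ r` decay with rate `γ`. -/
structure HasAvgBound (D : Set (Euc n)) (k : ℕ) (γ : ℝ) (w : Euc n → ℝ) (z₀ : Euc n) (r : ℝ) :
    Prop where
  integrable : Integrable w
  bound : ∀ (m : ℕ) (Θ : Euc n → ℝ), DerivSum (IsMeanZeroKernel (closedBall z₀ r)) k Θ →
    ∃ C : ℝ, 0 ≤ C ∧ ∀ ε : ℝ, 0 < ε → ∀ x, closedBall (x + ε • z₀) (ε * r) ⊆ D →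
      |avg w m Θ ε x| ≤ C * ε ^ (γ - m)

theorem IsSlobodeckij.hasAvgBound {D : Set (Euc n)} (hD : IsOpen D) {k : ℕ} {σ p : ℝ}
    (hσ : 0 ≤ σ) (hp : 1 < p) {u : Euc n → ℝ} {g : (Fin n → ℕ) → Euc n → ℝ}
    (hu : IsSlobodeckij D k σ p u g) (z₀ : Euc n) {r : ℝ} (hr : 0 < r) :
    HasAvgBound D k (k + σ - n / p) (D.indicator u) z₀ r :=
  ⟨hu.integrableOn.integrable_indicator hD.measurableSet,
    fun m _ hΘ => exists_avg_bound_of_derivSum hD hσ hp hu hr hΘ m⟩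

theorem HasAvgBound.exists_abs_sub_le {D : Set (Euc n)} {k : ℕ} {γ : ℝ} {w : Euc n → ℝ}
    {z₀ : Euc n} {r : ℝ} (hw : HasAvgBound D k γ w z₀ r) {m : ℕ} {Φ : Euc n → ℝ}
    (hΦ : IsGoodKernel (closedBall z₀ r) k m Φ) :
    ∃ C : ℝ, 0 ≤ C ∧ ∀ b : ℝ, b ≠ 0 → b ≤ γ - m → ∀ x ε₁ ε₂, 0 < ε₁ → ε₁ ≤ ε₂ → ε₂ ≤ 1 →
      (∀ e ∈ Icc ε₁ ε₂, closedBall (x + e • z₀) (e * r) ⊆ D) →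
      |avg w m Φ ε₂ x - avg w m Φ ε₁ x| ≤ C / b * (ε₂ ^ b - ε₁ ^ b) := by
  obtain ⟨C, hC0, hC⟩ := hw.bound (m + 1) _ hΦ.euler
  refine ⟨C, hC0, fun b hb hbγ x ε₁ ε₂ h1 h12 h2 hx => ?_⟩
  have hd : ∀ e ∈ Icc ε₁ ε₂, HasDerivAt (fun e => avg w m Φ e x - avg w m Φ ε₁ x)
      (-avg w (m + 1) (euler (n + m) Φ) e x) e := fun e he =>
    (hΦ.isKernel.hasDerivAt_avg (isCompact_closedBall z₀ r) hw.integrable m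
      (h1.trans_le he.1) x).sub_const _
  have hB : ∀ e ∈ Icc ε₁ ε₂, HasDerivAt (fun e : ℝ => C / b * (e ^ b - ε₁ ^ b))
      (C * e ^ (b - 1)) e := by
    intro e he
    refine (((Real.hasDerivAt_rpow_const (.inl (h1.trans_le he.1).ne')).sub_const _).const_mul
      (C / b)).congr_deriv ?_
    field_simp
  refine image_norm_le_of_norm_deriv_right_le_deriv_boundary'
    (f := fun e => avg w m Φ e x - avg w m Φ ε₁ x) (a := ε₁) (b := ε₂)
    (fun e he => (hd e he).continuousAt.continuousWithinAt)
    (fun e he => (hd e (Ico_subset_Icc_self he)).hasDerivWithinAt) (by simp)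
    (fun e he => (hB e he).continuousAt.continuousWithinAt)
    (fun e he => (hB e (Ico_subset_Icc_self he)).hasDerivWithinAt) (fun e he => ?_)
    (right_mem_Icc.2 h12)
  have he' := Ico_subset_Icc_self he
  rw [norm_neg, Real.norm_eq_abs]
  refine (hC e (h1.trans_le he.1) x (hx e he')).trans ?_
  refine mul_le_mul_of_nonneg_left ?_ hC0
  refine Real.rpow_le_rpow_of_exponent_ge (h1.trans_le he.1) (he'.2.trans h2) ?_
  push_cast
  linarith

/-- On `V ∩ D`, the sets `x + ε • closedBall z₀ (2 * r)` with `0 < ε ≤ 1` stay inside `D`. -/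
structure IsChart (D V : Set (Euc n)) (z₀ : Euc n) (r : ℝ) : Prop where
  isOpen : IsOpen V
  pos : 0 < r
  subset : ∀ x ∈ V ∩ D, ∀ ε : ℝ, 0 < ε → ε ≤ 1 → closedBall (x + ε • z₀) (ε * (2 * r)) ⊆ D

theorem IsChart.subset_of_dist_le {D V : Set (Euc n)} {z₀ : Euc n} {r : ℝ}
    (hV : IsChart D V z₀ r) {x y : Euc n} (hx : x ∈ V ∩ D) {ε : ℝ} (hε : 0 < ε) (hε1 : ε ≤ 1)
    (hy : ‖y - x‖ ≤ ε * r) : closedBall (y + ε • z₀) (ε * r) ⊆ D := by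
  refine Subset.trans (closedBall_subset_closedBall' ?_) (hV.subset x hx ε hε hε1)
  rw [dist_eq_norm, add_sub_add_right_eq_sub]
  linarith

theorem IsChart.closedBall_subset {D V : Set (Euc n)} {z₀ : Euc n} {r : ℝ}
    (hV : IsChart D V z₀ r) {x : Euc n} (hx : x ∈ V ∩ D) {ε : ℝ} (hε : 0 < ε) (hε1 : ε ≤ 1) :
    closedBall (x + ε • z₀) (ε * r) ⊆ D :=
  hV.subset_of_dist_le hx hε hε1 (by rw [sub_self, norm_zero]; exact (mul_pos hε hV.pos).le)

/-- `v` is, up to sign, the limit on `A` of the averages of `w` against a good kernel. -/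
structure IsAvgLimit (A : Set (Euc n)) (S : Set (Euc n)) (k m : ℕ) (w Φ v : Euc n → ℝ) :
    Prop where
  good : IsGoodKernel S k m Φ
  tendsto : ∀ x ∈ A, Tendsto (fun ε => (-1) ^ m * avg w m Φ ε x) (𝓝[>] 0) (𝓝 (v x))

theorem abs_neg_one_pow_mul (m : ℕ) (a : ℝ) : |(-1) ^ m * a| = |a| := by
  rw [abs_mul, abs_pow, abs_neg, abs_one, one_pow, one_mul]

theorem HasAvgBound.exists_isAvgLimit {D V : Set (Euc n)} {k : ℕ} {γ : ℝ} {w : Euc n → ℝ}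
    {z₀ : Euc n} {r : ℝ} (hw : HasAvgBound D k γ w z₀ r) (hV : IsChart D V z₀ r) {m : ℕ}
    (hm : m < γ) {Φ : Euc n → ℝ} (hΦ : IsGoodKernel (closedBall z₀ r) k m Φ) :
    ∃ v, IsAvgLimit (V ∩ D) (closedBall z₀ r) k m w Φ v := by
  obtain ⟨C, hC0, hC⟩ := hw.exists_abs_sub_le hΦ
  have hb : 0 < γ - m := by linarith
  have key : ∀ x ∈ V ∩ D, ∃ l, Tendsto (fun ε => (-1) ^ m * avg w m Φ ε x) (𝓝[>] 0) (𝓝 l) := by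
    intro x hx
    refine cauchy_map_iff_exists_tendsto.1 (Metric.cauchy_iff.2 ⟨inferInstance, fun δ hδ => ?_⟩)
    have ht : Tendsto (fun e : ℝ => C / (γ - m) * e ^ (γ - m)) (𝓝[>] 0) (𝓝 0) := by
      have := (Real.continuousAt_rpow_const 0 (γ - m) (.inr hb.le)).tendsto.const_mul (C / (γ - m))
      rw [Real.zero_rpow hb.ne', mul_zero] at this
      exact this.mono_left nhdsWithin_le_nhds
    have hev : ∀ᶠ e in 𝓝[>] (0 : ℝ), 0 < e ∧ e ≤ 1 ∧ C / (γ - m) * e ^ (γ - m) < δ := by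
      filter_upwards [self_mem_nhdsWithin, Ioc_mem_nhdsGT one_pos, ht.eventually_lt_const hδ]
        with e h1 h2 h3 using ⟨h1, h2.2, h3⟩
    refine ⟨_, image_mem_map hev, ?_⟩
    have main : ∀ e₁ e₂ : ℝ, 0 < e₁ → e₁ ≤ e₂ → e₂ ≤ 1 → C / (γ - m) * e₂ ^ (γ - m) < δ →
        |(-1) ^ m * avg w m Φ e₂ x - (-1) ^ m * avg w m Φ e₁ x| < δ := by
      intro e₁ e₂ h1 h12 h2 h
      rw [← mul_sub, abs_neg_one_pow_mul]
      refine (hC _ hb.ne' le_rfl x e₁ e₂ h1 h12 h2 fun e he =>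
        hV.closedBall_subset hx (h1.trans_le he.1) (he.2.trans h2)).trans_lt (lt_of_le_of_lt ?_ h)
      have : 0 ≤ e₁ ^ (γ - m) := by positivity
      gcongr
      linarith
    rintro _ ⟨e₁, he₁, rfl⟩ _ ⟨e₂, he₂, rfl⟩
    rcases le_total e₁ e₂ with h | h
    · rw [dist_comm]
      exact main e₁ e₂ he₁.1 h he₂.2.1 he₂.2.2
    · exact main e₂ e₁ he₂.1 h he₁.2.1 he₁.2.2
  choose! v hv using key
  exact ⟨v, hΦ, hv⟩

theorem IsAvgLimit.exists_rate {D V : Set (Euc n)} {k : ℕ} {γ : ℝ} {w : Euc n → ℝ}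
    {z₀ : Euc n} {r : ℝ} (hw : HasAvgBound D k γ w z₀ r) (hV : IsChart D V z₀ r) {m : ℕ}
    (hm : m < γ) {Φ v : Euc n → ℝ} (hv : IsAvgLimit (V ∩ D) (closedBall z₀ r) k m w Φ v) :
    ∃ C : ℝ, 0 ≤ C ∧ ∀ x ∈ V ∩ D, ∀ ε : ℝ, 0 < ε → ε ≤ 1 →
      |(-1) ^ m * avg w m Φ ε x - v x| ≤ C * ε ^ (γ - m) := by
  obtain ⟨C, hC0, hC⟩ := hw.exists_abs_sub_le hv.good
  have hb : 0 < γ - m := by linarith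
  refine ⟨C / (γ - m), by positivity, fun x hx ε hε hε1 => ?_⟩
  refine le_of_tendsto ((tendsto_const_nhds.sub (hv.tendsto x hx)).abs) ?_
  filter_upwards [Ioc_mem_nhdsGT hε] with e he
  rw [← mul_sub, abs_neg_one_pow_mul]
  refine (hC _ hb.ne' le_rfl x e ε he.1 he.2 hε1 fun e' he' =>
    hV.closedBall_subset hx (he.1.trans_le he'.1) (he'.2.trans hε1)).trans ?_
  have : 0 ≤ e ^ (γ - m) := Real.rpow_nonneg he.1.le _
  gcongr
  linarith

theorem tendsto_mul_one_div_rpow {C b : ℝ} (hb : 0 < b) :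
    Tendsto (fun N : ℕ => C * (1 / ((N : ℝ) + 1)) ^ b) atTop (𝓝 0) := by
  have := ((Real.continuousAt_rpow_const 0 b (.inr hb.le)).tendsto.const_mul C).comp
    tendsto_one_div_add_atTop_nhds_zero_nat
  rwa [Real.zero_rpow hb.ne', mul_zero] at this

theorem one_div_add_one_le_one (N : ℕ) : 1 / ((N : ℝ) + 1) ≤ 1 := by
  rw [div_le_one (by positivity)]
  linarith [N.cast_nonneg (α := ℝ)]

theorem IsAvgLimit.continuousOn {D V : Set (Euc n)} {k : ℕ} {γ : ℝ} {w : Euc n → ℝ}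
    {z₀ : Euc n} {r : ℝ} (hw : HasAvgBound D k γ w z₀ r) (hV : IsChart D V z₀ r) {m : ℕ}
    (hm : m < γ) {Φ v : Euc n → ℝ} (hv : IsAvgLimit (V ∩ D) (closedBall z₀ r) k m w Φ v) :
    ContinuousOn v (V ∩ D) := by
  obtain ⟨C, hC0, hC⟩ := hv.exists_rate hw hV hm
  have hunif : TendstoUniformlyOn
      (fun (N : ℕ) x => (-1) ^ m * avg w m Φ (1 / ((N : ℝ) + 1)) x) v atTop (V ∩ D) := by
    rw [Metric.tendstoUniformlyOn_iff]
    intro δ hδ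
    filter_upwards [(tendsto_mul_one_div_rpow (C := C) (b := γ - m)
      (by linarith)).eventually_lt_const hδ] with N hN x hx
    rw [dist_comm]
    exact (hC x hx _ (by positivity) (one_div_add_one_le_one N)).trans_lt hN
  refine hunif.continuousOn (Frequently.of_forall fun N => ?_)
  exact fun x _ => (((hv.good.isKernel.hasFDerivAt_avg (isCompact_closedBall z₀ r)
    hw.integrable m (by positivity) x).const_mul _).continuousAt).continuousWithinAt

theorem IsAvgLimit.hasFDerivAt {D V : Set (Euc n)} (hD : IsOpen D) {k : ℕ} {γ : ℝ}
    {w : Euc n → ℝ} {z₀ : Euc n} {r : ℝ} (hw : HasAvgBound D k γ w z₀ r)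
    (hV : IsChart D V z₀ r) {m : ℕ} (hm : m + 1 < γ) {Φ v : Euc n → ℝ}
    (hv : IsAvgLimit (V ∩ D) (closedBall z₀ r) k m w Φ v) {v' : Fin n → Euc n → ℝ}
    (hv' : ∀ i, IsAvgLimit (V ∩ D) (closedBall z₀ r) k (m + 1) w (pderiv i Φ) (v' i))
    {x : Euc n} (hx : x ∈ V ∩ D) :
    HasFDerivAt v (∑ i, v' i x • EuclideanSpace.proj (𝕜 := ℝ) i) x := by
  have hm' : ((m + 1 : ℕ) : ℝ) < γ := by
    push_cast
    exact hm
  choose C hC0 hC using fun i => (hv' i).exists_rate hw hV hm'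
  have hseq : Tendsto (fun N : ℕ => 1 / ((N : ℝ) + 1)) atTop (𝓝[>] 0) :=
    tendsto_nhdsWithin_iff.2 ⟨tendsto_one_div_add_atTop_nhds_zero_nat,
      Eventually.of_forall fun N => by
        rw [mem_Ioi]
        positivity⟩
  refine hasFDerivAt_of_tendstoUniformlyOn (l := atTop) (hV.isOpen.inter hD)
    (f := fun (N : ℕ) x => (-1) ^ m * avg w m Φ (1 / ((N : ℝ) + 1)) x)
    (f' := fun (N : ℕ) x => ∑ i, ((-1) ^ (m + 1) *
      avg w (m + 1) (pderiv i Φ) (1 / ((N : ℝ) + 1)) x) • EuclideanSpace.proj (𝕜 := ℝ) i)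
    (g' := fun x => ∑ i, v' i x • EuclideanSpace.proj (𝕜 := ℝ) i) ?_ ?_
    (fun y hy => (hv.tendsto y hy).comp hseq) hx
  · rw [Metric.tendstoUniformlyOn_iff]
    intro δ hδ
    filter_upwards [(tendsto_mul_one_div_rpow
      (C := ∑ i, C i * ‖(EuclideanSpace.proj (𝕜 := ℝ) i : Euc n →L[ℝ] ℝ)‖) (b := γ - (m + 1 : ℕ))
      (by linarith)).eventually_lt_const hδ] with N hN y hy
    rw [dist_comm, dist_eq_norm, ← Finset.sum_sub_distrib]
    refine lt_of_le_of_lt ((norm_sum_le _ _).trans ?_) hN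
    rw [Finset.sum_mul]
    refine Finset.sum_le_sum fun i _ => ?_
    rw [← sub_smul, norm_smul, mul_right_comm]
    exact mul_le_mul_of_nonneg_right
      (hC i y hy _ (by positivity) (one_div_add_one_le_one N)) (norm_nonneg _)
  · intro N y _
    refine ((hv.good.isKernel.hasFDerivAt_avg (isCompact_closedBall z₀ r)
      hw.integrable m (by positivity) y).const_mul ((-1) ^ m)).congr_fderiv ?_
    rw [Finset.smul_sum]
    refine Finset.sum_congr rfl fun i _ => ?_
    rw [smul_smul]
    congr 1
    ring

theorem IsAvgLimit.pderiv {D V : Set (Euc n)} (hD : IsOpen D) {k : ℕ} {γ : ℝ}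
    {w : Euc n → ℝ} {z₀ : Euc n} {r : ℝ} (hw : HasAvgBound D k γ w z₀ r)
    (hV : IsChart D V z₀ r) {m : ℕ} (hm : m + 1 < γ) {Φ v : Euc n → ℝ}
    (hv : IsAvgLimit (V ∩ D) (closedBall z₀ r) k m w Φ v) :
    (∀ x ∈ V ∩ D, DifferentiableAt ℝ v x) ∧ ∀ i,
      IsAvgLimit (V ∩ D) (closedBall z₀ r) k (m + 1) w (_root_.pderiv i Φ) (_root_.pderiv i v) := by
  have hm' : ((m + 1 : ℕ) : ℝ) < γ := by
    push_cast
    exact hm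
  choose v' hv' using fun i =>
    hw.exists_isAvgLimit hV hm' (hv.good.pderiv (isCompact_closedBall z₀ r) i)
  have key := fun x (hx : x ∈ V ∩ D) => hv.hasFDerivAt hD hw hV hm hv' hx
  refine ⟨fun x hx => (key x hx).differentiableAt, fun i => ⟨(hv' i).good, fun x hx => ?_⟩⟩
  have : _root_.pderiv i v x = v' i x := by
    rw [_root_.pderiv, (key x hx).fderiv]
    simp
  rw [this]
  exact (hv' i).tendsto x hx

theorem IsAvgLimit.iterate_pderiv {D V : Set (Euc n)} (hD : IsOpen D) {k : ℕ} {γ : ℝ}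
    {w : Euc n → ℝ} {z₀ : Euc n} {r : ℝ} (hw : HasAvgBound D k γ w z₀ r)
    (hV : IsChart D V z₀ r) {m : ℕ} {Φ v : Euc n → ℝ}
    (hv : IsAvgLimit (V ∩ D) (closedBall z₀ r) k m w Φ v) (i : Fin n) (j : ℕ)
    (hm : m + j < γ) :
    ∃ Φ', IsAvgLimit (V ∩ D) (closedBall z₀ r) k (m + j) w Φ' ((_root_.pderiv i)^[j] v) := by
  induction j with
  | zero => exact ⟨Φ, hv⟩
  | succ j ih =>
    push_cast at hm
    obtain ⟨Φ', h⟩ := ih (by linarith)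
    rw [Function.iterate_succ_apply']
    exact ⟨_, (h.pderiv hD hw hV (by push_cast; linarith)).2 i⟩

theorem IsAvgLimit.multiDeriv {D V : Set (Euc n)} (hD : IsOpen D) {k : ℕ} {γ : ℝ}
    {w : Euc n → ℝ} {z₀ : Euc n} {r : ℝ} (hw : HasAvgBound D k γ w z₀ r)
    (hV : IsChart D V z₀ r) {Φ v : Euc n → ℝ}
    (hv : IsAvgLimit (V ∩ D) (closedBall z₀ r) k 0 w Φ v) (α : Fin n → ℕ)
    (hα : degree α < γ) :
    ∃ Φ', IsAvgLimit (V ∩ D) (closedBall z₀ r) k (degree α) w Φ' (_root_.multiDeriv α v) := by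
  have key : ∀ L : List (Fin n), (((L.map α).sum : ℕ) : ℝ) < γ →
      ∃ Φ', IsAvgLimit (V ∩ D) (closedBall z₀ r) k ((L.map α).sum) w Φ'
        (L.foldr (fun i g => (_root_.pderiv i)^[α i] g) v) := by
    intro L
    induction L with
    | nil => exact fun _ => ⟨Φ, hv⟩
    | cons i L ih =>
      intro h
      rw [List.map_cons, List.sum_cons, add_comm] at h ⊢
      rw [Nat.cast_add] at h
      obtain ⟨Φ', h'⟩ := ih (by linarith [(α i).cast_nonneg (α := ℝ)])
      exact h'.iterate_pderiv hD hw hV i (α i) h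
  have hdeg : degree α = ((List.finRange n).map α).sum := by
    rw [degree, ← List.ofFn_eq_map, List.sum_ofFn]
  rw [hdeg] at hα ⊢
  exact key _ hα

theorem IsAvgLimit.contDiffOn {D V : Set (Euc n)} (hD : IsOpen D) {k : ℕ} {γ : ℝ}
    {w : Euc n → ℝ} {z₀ : Euc n} {r : ℝ} (hw : HasAvgBound D k γ w z₀ r)
    (hV : IsChart D V z₀ r) (j : ℕ) : ∀ {m : ℕ} {Φ v : Euc n → ℝ},
    IsAvgLimit (V ∩ D) (closedBall z₀ r) k m w Φ v → m + j < γ →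
      ContDiffOn ℝ j v (V ∩ D) := by
  induction j with
  | zero =>
    intro m Φ v hv hm
    exact contDiffOn_zero.2 (hv.continuousOn hw hV (by simpa using hm))
  | succ j ih =>
    intro m Φ v hv hm
    push_cast at hm
    obtain ⟨hd, hp⟩ := hv.pderiv hD hw hV (by linarith [j.cast_nonneg (α := ℝ)])
    push_cast
    refine (contDiffOn_succ_iff_fderiv_of_isOpen (hV.isOpen.inter hD)).2
      ⟨fun x hx => (hd x hx).differentiableWithinAt, by simp, ?_⟩
    rw [show fderiv ℝ v = fun x => ∑ i, _root_.pderiv i v x • EuclideanSpace.proj (𝕜 := ℝ) i from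
      funext fun x => fderiv_eq_sum_pderiv v x]
    refine ContDiffOn.sum fun i _ => ?_
    exact (ih (hp i) (by push_cast; linarith)).smul contDiffOn_const

theorem IsAvgLimit.exists_bound {D V : Set (Euc n)} {k : ℕ} {γ : ℝ}
    {w : Euc n → ℝ} {z₀ : Euc n} {r : ℝ} (hw : HasAvgBound D k γ w z₀ r)
    (hV : IsChart D V z₀ r) {m : ℕ} (hm : m < γ) {Φ v : Euc n → ℝ}
    (hv : IsAvgLimit (V ∩ D) (closedBall z₀ r) k m w Φ v) :
    ∃ K : ℝ, 0 ≤ K ∧ ∀ x ∈ V ∩ D, |v x| ≤ K := by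
  obtain ⟨C, hC0, hC⟩ := hv.exists_rate hw hV hm
  obtain ⟨M, hM0, hM⟩ := hv.good.isKernel.exists_avg_bound (isCompact_closedBall z₀ r)
    hw.integrable m
  refine ⟨M + C, by positivity, fun x hx => ?_⟩
  have h1 := hC x hx 1 one_pos le_rfl
  have h2 := hM 1 one_pos x
  rw [Real.one_rpow, mul_one] at h1
  rw [one_pow, inv_one, one_mul, ← abs_neg_one_pow_mul m] at h2
  have h3 := abs_sub_abs_le_abs_sub (v x) ((-1) ^ m * avg w m Φ 1 x)
  rw [abs_sub_comm] at h3
  linarith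

theorem HasAvgBound.exists_gradient_bound {D V : Set (Euc n)} {k : ℕ} {γ : ℝ}
    {w : Euc n → ℝ} {z₀ : Euc n} {r : ℝ} (hw : HasAvgBound D k γ w z₀ r)
    (hV : IsChart D V z₀ r) {m : ℕ} {a : ℝ} (ha : a < 1) {Φ : Euc n → ℝ}
    (hΦ : IsGoodKernel (closedBall z₀ r) k m Φ) (ham : a - 1 ≤ γ - m) :
    ∃ C : ℝ, 0 ≤ C ∧ ∀ x ∈ V ∩ D, ∀ ε : ℝ, 0 < ε → ε ≤ 1 → ∀ y, ‖y - x‖ ≤ ε * r →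
      |avg w m Φ ε y| ≤ C * ε ^ (a - 1) := by
  obtain ⟨C, hC0, hC⟩ := hw.exists_abs_sub_le hΦ
  obtain ⟨M, hM0, hM⟩ := hΦ.isKernel.exists_avg_bound (isCompact_closedBall z₀ r)
    hw.integrable m
  have ha' : 0 < 1 - a := by linarith
  refine ⟨M + C / (1 - a), by positivity, fun x hx ε hε hε1 y hy => ?_⟩
  have h1 := hC (a - 1) (by linarith) ham y ε 1 hε hε1 le_rfl fun e he => by
    refine hV.subset_of_dist_le hx (hε.trans_le he.1) he.2 (hy.trans ?_)
    exact mul_le_mul_of_nonneg_right he.1 hV.pos.le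
  have h2 := hM 1 one_pos y
  rw [one_pow, inv_one, one_mul] at h2
  have h3 : C / (a - 1) * (1 ^ (a - 1) - ε ^ (a - 1)) ≤ C / (1 - a) * ε ^ (a - 1) := by
    have e : C / (a - 1) = -(C / (1 - a)) := by
      rw [← neg_sub 1 a, div_neg]
    rw [e, Real.one_rpow]
    have : 0 ≤ C / (1 - a) := by positivity
    linarith
  have h4 : 1 ≤ ε ^ (a - 1) :=
    Real.one_le_rpow_of_pos_of_le_one_of_nonpos hε hε1 (by linarith)
  have h5 := abs_sub_abs_le_abs_sub (avg w m Φ ε y) (avg w m Φ 1 y)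
  rw [abs_sub_comm] at h5
  have h6 := le_mul_of_one_le_right hM0 h4
  linarith

theorem IsAvgLimit.exists_holder {D V : Set (Euc n)} {k : ℕ} {γ : ℝ}
    {w : Euc n → ℝ} {z₀ : Euc n} {r : ℝ} (hw : HasAvgBound D k γ w z₀ r)
    (hV : IsChart D V z₀ r) {m : ℕ} {a : ℝ} (ha0 : 0 ≤ a) (ha : a < 1) (hm : m + a < γ)
    {Φ v : Euc n → ℝ} (hv : IsAvgLimit (V ∩ D) (closedBall z₀ r) k m w Φ v) :
    ∃ K : ℝ, 0 ≤ K ∧ ∀ x ∈ V ∩ D, ∀ y ∈ V ∩ D, ‖x - y‖ ≤ r → |v x - v y| ≤ K * ‖x - y‖ ^ a := by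
  have hS := isCompact_closedBall z₀ r
  have hr := hV.pos
  obtain ⟨C, hC0, hC⟩ := hv.exists_rate hw hV (by linarith)
  choose M hM0 hM using fun i => hw.exists_gradient_bound hV ha (m := m + 1)
    (hv.good.pderiv hS i) (by push_cast; linarith)
  set G := ∑ i, M i * ‖(EuclideanSpace.proj (𝕜 := ℝ) i : Euc n →L[ℝ] ℝ)‖ with hG
  have hG0 : 0 ≤ G := Finset.sum_nonneg fun i _ => mul_nonneg (hM0 i) (norm_nonneg _)
  refine ⟨(2 * C + G * r) / r ^ a, by positivity, fun x hx y hy hxy => ?_⟩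
  rcases eq_or_ne x y with rfl | hne
  · rw [sub_self, abs_zero]
    positivity
  have hpos : 0 < ‖x - y‖ := norm_pos_iff.2 (sub_ne_zero.2 hne)
  set ε := ‖x - y‖ / r with hε
  have hε0 : 0 < ε := by positivity
  have hε1 : ε ≤ 1 := (div_le_one hr).2 hxy
  have hεr : ε * r = ‖x - y‖ := by
    rw [hε]
    field_simp
  have hpow : ε ^ (γ - m) ≤ ε ^ a := Real.rpow_le_rpow_of_exponent_ge hε0 hε1 (by linarith)
  have hx' := (hC x hx ε hε0 hε1).trans (mul_le_mul_of_nonneg_left hpow hC0)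
  have hy' := (hC y hy ε hε0 hε1).trans (mul_le_mul_of_nonneg_left hpow hC0)
  have hgrad : |avg w m Φ ε x - avg w m Φ ε y| ≤ G * ε ^ (a - 1) * ‖x - y‖ := by
    have := (convex_segment y x).norm_image_sub_le_of_norm_hasFDerivWithin_le (𝕜 := ℝ)
      (C := G * ε ^ (a - 1))
      (fun z _ => (hv.good.isKernel.hasFDerivAt_avg hS hw.integrable m hε0 z).hasFDerivWithinAt)
      (fun z hz => ?_) (left_mem_segment ℝ y x) (right_mem_segment ℝ y x)
    · exact this
    · refine (norm_sum_le _ _).trans ?_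
      rw [hG, Finset.sum_mul]
      refine Finset.sum_le_sum fun i _ => ?_
      rw [norm_smul, norm_neg, mul_right_comm]
      refine mul_le_mul_of_nonneg_right (hM i x hx ε hε0 hε1 z ?_) (norm_nonneg _)
      rw [hεr]
      have := norm_sub_le_of_mem_segment (segment_symm ℝ y x ▸ hz)
      rwa [norm_sub_rev x y]
  have hsplit : G * ε ^ (a - 1) * ‖x - y‖ = G * r * ε ^ a := by
    rw [← hεr, Real.rpow_sub_one hε0.ne']
    field_simp
  rw [hsplit] at hgrad
  have hdiv : (2 * C + G * r) / r ^ a * ‖x - y‖ ^ a = (2 * C + G * r) * ε ^ a := by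
    rw [hε, Real.div_rpow (norm_nonneg _) hr.le]
    ring
  rw [hdiv]
  rw [← abs_neg_one_pow_mul m, mul_sub] at hgrad
  rw [abs_le] at *
  constructor <;> linarith [hx'.1, hx'.2, hy'.1, hy'.2, hgrad.1, hgrad.2]

/-! ### Charts for domains of cone type -/

theorem isOpen_cone (a h : ℝ) (v : Euc n) : IsOpen (cone a h v) := by
  refine (isOpen_lt (by fun_prop) (by fun_prop)).and
    ((isOpen_lt (by fun_prop) (by fun_prop)).and (isOpen_lt (by fun_prop) (by fun_prop)))

theorem smul_mem_cone {a h : ℝ} {v z : Euc n} (hz : z ∈ cone a h v) {ε : ℝ} (hε : 0 < ε)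
    (hε1 : ε ≤ 1) : ε • z ∈ cone a h v := by
  obtain ⟨h1, h2, h3⟩ := hz
  have e : ⟪ε • z, v⟫ = ε * ⟪z, v⟫ := by rw [real_inner_smul_left]
  refine ⟨?_, ?_, ?_⟩
  · rw [e]
    positivity
  · rw [e]
    nlinarith
  · rw [e, mul_smul, ← smul_sub, norm_smul, Real.norm_eq_abs, abs_of_pos hε]
    nlinarith

theorem half_smul_mem_cone {a h : ℝ} (ha : 0 < a) (hh : 0 < h) {v : Euc n} (hv : ‖v‖ = 1) :
    (h / 2) • v ∈ cone a h v := by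
  have e : ⟪(h / 2) • v, v⟫ = h / 2 := by
    rw [real_inner_smul_left, real_inner_self_eq_norm_sq, hv]
    ring
  refine ⟨?_, ?_, ?_⟩
  · rw [e]
    positivity
  · rw [e]
    linarith
  · rw [e, sub_self, norm_zero]
    positivity

theorem exists_isChart_of_cone {D U : Set (Euc n)} (hU : IsOpen U) {a h : ℝ} (ha : 0 < a)
    (hh : 0 < h) {v : Euc n} (hv : ‖v‖ = 1) (hsub : (U ∩ D) + cone a h v ⊆ D) :
    ∃ z r, IsChart D U z r := by
  obtain ⟨δ, hδ, hball⟩ := Metric.nhds_basis_closedBall.mem_iff.1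
    ((isOpen_cone a h v).mem_nhds (half_smul_mem_cone ha hh hv))
  refine ⟨(h / 2) • v, δ / 2, hU, half_pos hδ, fun x hx ε hε hε1 y hy => ?_⟩
  have hz : ε⁻¹ • (y - x) ∈ cone a h v := by
    refine hball ?_
    rw [mem_closedBall, dist_eq_norm] at hy ⊢
    have e : ε⁻¹ • (y - x) - (h / 2) • v = ε⁻¹ • (y - (x + ε • (h / 2) • v)) := by
      rw [← sub_sub, smul_sub ε⁻¹ (y - x), inv_smul_smul₀ hε.ne']
    rw [e, norm_smul, norm_inv, Real.norm_eq_abs, abs_of_pos hε, inv_mul_le_iff₀ hε]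
    linarith
  have := hsub (add_mem_add hx (smul_mem_cone hz hε hε1))
  rwa [smul_inv_smul₀ hε.ne', add_sub_cancel] at this

theorem exists_isChart_of_isCompact {D K : Set (Euc n)} (hD : IsOpen D) (hK : IsCompact K)
    (hKD : K ⊆ D) : ∃ U z r, K ⊆ U ∧ IsChart D U z r := by
  obtain ⟨δ, hδ, hsub⟩ := hK.exists_cthickening_subset_open hD hKD
  refine ⟨thickening (δ / 2) K, 0, δ / 4, self_subset_thickening (half_pos hδ) K,
    isOpen_thickening, by positivity, fun x hx ε hε hε1 y hy => hsub ?_⟩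
  obtain ⟨z, hz, hxz⟩ := mem_thickening_iff.1 hx.1
  refine mem_cthickening_of_dist_le y z δ K hz ?_
  rw [smul_zero, add_zero, mem_closedBall] at hy
  have := dist_triangle y x z
  nlinarith

theorem IsConeType.exists_charts {D : Set (Euc n)} (hD : IsOpen D) (hb : Bornology.IsBounded D)
    (h : IsConeType D) : ∃ (ι : Type) (_ : Fintype ι) (V : ι → Set (Euc n)) (z : ι → Euc n)
      (r : ι → ℝ), (∀ j, IsChart D (V j) (z j) (r j)) ∧ closure D ⊆ ⋃ j, V j := by
  obtain ⟨a, h, ha, hh, m, U, v, hU, hv, hfr, hsub⟩ := h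
  have hK : IsCompact (closure D \ ⋃ j, U j) := hb.isCompact_closure.diff (isOpen_iUnion hU)
  have hKD : closure D \ ⋃ j, U j ⊆ D := by
    intro x hx
    by_contra hxD
    refine hx.2 (hfr ?_)
    rw [hD.frontier_eq]
    exact ⟨hx.1, hxD⟩
  obtain ⟨U₀, z₀, r₀, hsub₀, hch₀⟩ := exists_isChart_of_isCompact hD hK hKD
  choose z r hch using fun j => exists_isChart_of_cone (hU j) ha hh (hv j) (hsub j)
  refine ⟨Option (Fin m), inferInstance, fun j => j.elim U₀ U, fun j => j.elim z₀ z,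
    fun j => j.elim r₀ r, ?_, ?_⟩
  · rintro (_ | j)
    · exact hch₀
    · exact hch j
  · intro x hx
    by_cases hxU : x ∈ ⋃ j, U j
    · obtain ⟨j, hj⟩ := mem_iUnion.1 hxU
      exact mem_iUnion.2 ⟨some j, hj⟩
    · exact mem_iUnion.2 ⟨none, hsub₀ ⟨hx, hxU⟩⟩

/-! ### Hölder regularity -/

theorem le_div_rpow_mul_rpow {B r d a : ℝ} (hB : 0 ≤ B) (hr : 0 < r) (hrd : r ≤ d)
    (ha : 0 ≤ a) : B ≤ B / r ^ a * d ^ a := by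
  have h1 : r ^ a ≤ d ^ a := Real.rpow_le_rpow hr.le hrd ha
  have h2 : 0 < r ^ a := Real.rpow_pos_of_pos hr a
  rw [div_mul_eq_mul_div, le_div_iff₀ h2]
  gcongr

theorem IsAvgLimit.exists_bound_holder {D V : Set (Euc n)} {k : ℕ} {γ : ℝ}
    {w : Euc n → ℝ} {z₀ : Euc n} {r : ℝ} (hw : HasAvgBound D k γ w z₀ r)
    (hV : IsChart D V z₀ r) {m : ℕ} {a : ℝ} (ha0 : 0 ≤ a) (ha : a < 1) (hm : m + a < γ)
    {Φ v : Euc n → ℝ} (hv : IsAvgLimit (V ∩ D) (closedBall z₀ r) k m w Φ v) :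
    ∃ K : ℝ, 0 ≤ K ∧ (∀ x ∈ V ∩ D, |v x| ≤ K) ∧
      ∀ x ∈ V ∩ D, ∀ y ∈ V ∩ D, |v x - v y| ≤ K * ‖x - y‖ ^ a := by
  obtain ⟨K₁, h₁0, h₁⟩ := hv.exists_bound hw hV (by linarith)
  obtain ⟨K₂, h₂0, h₂⟩ := hv.exists_holder hw hV ha0 ha hm
  have hr := hV.pos
  have hq : 0 ≤ 2 * K₁ / r ^ a := by positivity
  refine ⟨K₁ + K₂ + 2 * K₁ / r ^ a, by positivity, fun x hx => by linarith [h₁ x hx],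
    fun x hx y hy => ?_⟩
  have hp : 0 ≤ ‖x - y‖ ^ a := by positivity
  rcases le_total (‖x - y‖) r with h | h
  · refine (h₂ x hx y hy h).trans ?_
    gcongr
    linarith
  · have h3 : |v x - v y| ≤ 2 * K₁ :=
      (abs_sub _ _).trans (by linarith [h₁ x hx, h₁ y hy])
    refine (h3.trans (le_div_rpow_mul_rpow (by positivity) hr h ha0)).trans ?_
    gcongr
    linarith

theorem exists_bound_holder_of_cover {D : Set (Euc n)} (hb : Bornology.IsBounded D) {ι : Type}
    [Fintype ι] {V : ι → Set (Euc n)} (hVo : ∀ j, IsOpen (V j)) (hV : closure D ⊆ ⋃ j, V j)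
    {a : ℝ} (ha0 : 0 ≤ a) {v : Euc n → ℝ}
    (h : ∀ j, ∃ K : ℝ, 0 ≤ K ∧ (∀ x ∈ V j ∩ D, |v x| ≤ K) ∧
      ∀ x ∈ V j ∩ D, ∀ y ∈ V j ∩ D, |v x - v y| ≤ K * ‖x - y‖ ^ a) :
    ∃ K : ℝ, (∀ x ∈ D, |v x| ≤ K) ∧ ∀ x ∈ D, ∀ y ∈ D, |v x - v y| ≤ K * ‖x - y‖ ^ a := by
  choose K hK0 hK₁ hK₂ using h
  obtain ⟨δ, hδ, hδV⟩ := lebesgue_number_lemma_of_metric hb.isCompact_closure hVo hV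
  set K₀ := ∑ j, K j with hK₀
  have hle : ∀ j, K j ≤ K₀ := fun j =>
    Finset.single_le_sum (fun i _ => hK0 i) (Finset.mem_univ j)
  have hK₀0 : 0 ≤ K₀ := Finset.sum_nonneg fun i _ => hK0 i
  have hq : 0 ≤ 2 * K₀ / δ ^ a := by positivity
  have hbd : ∀ x ∈ D, |v x| ≤ K₀ := by
    intro x hx
    obtain ⟨j, hj⟩ := mem_iUnion.1 (hV (subset_closure hx))
    exact (hK₁ j x ⟨hj, hx⟩).trans (hle j)
  refine ⟨K₀ + 2 * K₀ / δ ^ a, fun x hx => by linarith [hbd x hx], fun x hx y hy => ?_⟩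
  have hp : 0 ≤ ‖x - y‖ ^ a := by positivity
  rcases lt_or_ge (‖x - y‖) δ with h | h
  · obtain ⟨j, hj⟩ := hδV x (subset_closure hx)
    have hyj : y ∈ V j := hj (by rwa [mem_ball, dist_comm, dist_eq_norm])
    refine (hK₂ j x ⟨hj (mem_ball_self hδ), hx⟩ y ⟨hyj, hy⟩).trans ?_
    gcongr
    linarith [hle j]
  · have h3 : |v x - v y| ≤ 2 * K₀ :=
      (abs_sub _ _).trans (by linarith [hbd x hx, hbd y hy])
    refine (h3.trans (le_div_rpow_mul_rpow (by positivity) hδ h ha0)).trans ?_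
    gcongr
    linarith

theorem integral_comp_inv_smul_sub (Ψ : Euc n → ℝ) {ε : ℝ} (hε : 0 < ε) (x : Euc n) :
    ∫ y, Ψ (ε⁻¹ • (y - x)) = ε ^ n * ∫ z, Ψ z := by
  rw [integral_sub_right_eq_self (fun y => Ψ (ε⁻¹ • y)) x, Measure.integral_comp_smul,
    finrank_euclideanSpace_fin, smul_eq_mul, inv_pow, inv_inv, abs_of_pos (by positivity)]

theorem isAvgLimit_self {D A : Set (Euc n)} (hD : IsOpen D) (hA : A ⊆ D) {u : Euc n → ℝ}
    (hu : IntegrableOn u D) (huc : ContinuousOn u D) {z₀ : Euc n} {r : ℝ} {k : ℕ}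
    {Ψ : Euc n → ℝ} (hΨ : IsGoodKernel (closedBall z₀ r) k 0 Ψ) (hΨ1 : ∫ z, Ψ z = 1) :
    IsAvgLimit A (closedBall z₀ r) k 0 (D.indicator u) Ψ u := by
  refine ⟨hΨ, fun x hx => ?_⟩
  have hS := isCompact_closedBall z₀ r
  have hui : Integrable (D.indicator u) := hu.integrable_indicator hD.measurableSet
  have hΨi : Integrable Ψ := hΨ.isKernel.integrable hS
  have hcont : ContinuousAt (D.indicator u) x :=
    (huc.continuousAt (hD.mem_nhds (hA hx))).congr
      (Filter.eventually_of_mem (hD.mem_nhds (hA hx)) fun y hy => (indicator_of_mem hy u).symm)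
  have hux : D.indicator u x = u x := indicator_of_mem (hA hx) u
  set I := ∫ z, |Ψ z| with hI
  have hI0 : 0 ≤ I := integral_nonneg fun z => abs_nonneg _
  rw [Metric.tendsto_nhds]
  intro δ hδ
  have hδ' : 0 < δ / (I + 1) := by positivity
  obtain ⟨η, hη, hball⟩ := Metric.continuousAt_iff.1 hcont _ hδ'
  have hR : 0 < ‖z₀‖ + |r| + 1 := by positivity
  filter_upwards [Ioo_mem_nhdsGT (div_pos hη hR)] with ε hε
  have hε0 : 0 < ε := hε.1
  have hεR : ε * (‖z₀‖ + |r| + 1) < η := (lt_div_iff₀ hR).1 hε.2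
  have hcc : Integrable fun y => Ψ (ε⁻¹ • (y - x)) :=
    (hΨi.comp_smul (inv_ne_zero hε0.ne')).comp_sub_right x
  have hid : avg (D.indicator u) 0 Ψ ε x - u x =
      (ε ^ n)⁻¹ * ∫ y, (D.indicator u y - u x) * Ψ (ε⁻¹ • (y - x)) := by
    simp only [sub_mul]
    rw [integral_sub (hΨ.isKernel.integrable_mul hS hui _ _) (hcc.const_mul _),
      integral_const_mul, integral_comp_inv_smul_sub Ψ hε0, hΨ1, mul_sub, avg, add_zero]
    field_simp
  rw [pow_zero, one_mul, Real.dist_eq, hid, abs_mul, abs_of_pos (by positivity)]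
  have hle : |∫ y, (D.indicator u y - u x) * Ψ (ε⁻¹ • (y - x))| ≤
      ∫ y, δ / (I + 1) * |Ψ (ε⁻¹ • (y - x))| := by
    rw [← Real.norm_eq_abs]
    refine norm_integral_le_of_norm_le (hcc.abs.const_mul _) (Eventually.of_forall fun y => ?_)
    rw [norm_mul, Real.norm_eq_abs, Real.norm_eq_abs]
    by_cases hy : ε⁻¹ • (y - x) ∈ closedBall z₀ r
    · refine mul_le_mul_of_nonneg_right ?_ (abs_nonneg _)
      rw [← hux, ← Real.dist_eq]
      refine (hball ?_).le
      have h1 : ‖ε⁻¹ • (y - x)‖ ≤ ‖z₀‖ + |r| := by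
        have := norm_le_of_mem_closedBall hy
        linarith [le_abs_self r]
      rw [norm_smul, norm_inv, Real.norm_eq_abs, abs_of_pos hε0, inv_mul_le_iff₀ hε0] at h1
      rw [dist_eq_norm]
      linarith
    · rw [hΨ.isKernel.2 _ hy, abs_zero, mul_zero, mul_zero]
  rw [integral_const_mul, integral_comp_inv_smul_sub (fun z => |Ψ z|) hε0, ← hI] at hle
  calc (ε ^ n)⁻¹ * |∫ y, (D.indicator u y - u x) * Ψ (ε⁻¹ • (y - x))|
      ≤ (ε ^ n)⁻¹ * (δ / (I + 1) * (ε ^ n * I)) := by gcongr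
    _ = δ * (I / (I + 1)) := by field_simp
    _ < δ * 1 := by
      gcongr
      rw [div_lt_one (by positivity)]
      linarith
    _ = δ := mul_one δ

theorem IsSlobodeckij.holderClassOn {D : Set (Euc n)} (hD : IsOpen D)
    (hb : Bornology.IsBounded D) (hcone : IsConeType D) {k : ℕ} {σ p : ℝ} (hσ : 0 ≤ σ)
    (hp : 1 < p) {u : Euc n → ℝ} {g : (Fin n → ℕ) → Euc n → ℝ} (hu : IsSlobodeckij D k σ p u g)
    (huc : ContinuousOn u D) {t : ℝ} (ht0 : 0 ≤ t) (ht : t < k + σ - n / p) :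
    HolderClassOn t u D := by
  obtain ⟨ι, _, V, z, r, hch, hcov⟩ := hcone.exists_charts hD hb
  have hw := fun j => hu.hasAvgBound hD hσ hp (z j) (hch j).pos
  choose Ψ hΨ hΨ1 using fun j => exists_isGoodKernel (isCompact_closedBall (z j) (r j)) k
    (hch j).pos subset_rfl
  have hlim : ∀ j, IsAvgLimit (V j ∩ D) (closedBall (z j) (r j)) k 0 (D.indicator u) (Ψ j) u :=
    fun j => isAvgLimit_self hD inter_subset_right hu.integrableOn huc (hΨ j) (hΨ1 j)
  have hfl : (⌊t⌋₊ : ℝ) ≤ t := Nat.floor_le ht0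
  have hfl' : t < ⌊t⌋₊ + 1 := Nat.lt_floor_add_one t
  refine ⟨fun x hx => ?_, fun α hα => ?_⟩
  · obtain ⟨j, hj⟩ := mem_iUnion.1 (hcov (subset_closure hx))
    have hcd := (hlim j).contDiffOn hD (hw j) (hch j) ⌊t⌋₊
      (by rw [Nat.cast_zero, zero_add]; linarith)
    exact (hcd.contDiffAt (((hch j).isOpen.inter hD).mem_nhds ⟨hj, hx⟩)).contDiffWithinAt
  · have hα' : (degree α : ℝ) ≤ ⌊t⌋₊ := by exact_mod_cast hα
    refine exists_bound_holder_of_cover hb (fun j => (hch j).isOpen) hcov (by linarith)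
      fun j => ?_
    obtain ⟨Φ, hΦ⟩ := (hlim j).multiDeriv hD (hw j) (hch j) α (by linarith)
    exact hΦ.exists_bound_holder (hw j) (hch j) (by linarith) (by linarith) (by linarith)

/-! ### Integrability from the Sobolev norm -/

theorem integrableOn_of_lintegral_rpow_lt_top {D : Set (Euc n)} (hD : IsOpen D)
    (hb : Bornology.IsBounded D) {p : ℝ} (hp : 1 < p) {u : Euc n → ℝ} (huc : ContinuousOn u D)
    (h : ∫⁻ x in D, ENNReal.ofReal (|u x| ^ p) < ⊤) : IntegrableOn u D := by
  have hm : AEStronglyMeasurable u (volume.restrict D) :=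
    huc.aestronglyMeasurable hD.measurableSet
  have hc : IntegrableOn (fun _ : Euc n => (1 : ℝ)) D :=
    integrableOn_const hb.measure_lt_top.ne
  have hi : IntegrableOn (fun x => |u x| ^ p) D := by
    have hcp : ContinuousOn (fun x => |u x| ^ p) D :=
      huc.abs.rpow_const fun x _ => .inr (by linarith)
    refine ⟨hcp.aestronglyMeasurable hD.measurableSet, ?_⟩
    rw [hasFiniteIntegral_iff_norm]
    refine lt_of_le_of_lt (lintegral_mono fun x => ?_) h
    rw [Real.norm_of_nonneg (by positivity)]
  refine (hc.add hi).mono' hm (Eventually.of_forall fun x => ?_)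
  have := le_add_rpow_mul_rpow (abs_nonneg (u x)) one_pos hp
  simpa using this

theorem integrableOn_slobodeckij_of_lintegral_lt_top {D : Set (Euc n)} {σ p : ℝ}
    {w : Euc n → ℝ} (hw : LocallyIntegrableOn w D)
    (h : ∫⁻ q in D ×ˢ D, ENNReal.ofReal (slobodeckij σ p w q) < ⊤) :
    IntegrableOn (slobodeckij σ p w) (D ×ˢ D) := by
  have hm : AEStronglyMeasurable w (volume.restrict D) := hw.aestronglyMeasurable
  refine ⟨?_, ?_⟩
  · rw [Measure.volume_eq_prod, ← Measure.prod_restrict]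
    have h1 : AEMeasurable w (volume.restrict D) := hm.aemeasurable
    have h2 : AEMeasurable (fun q : Euc n × Euc n => |w q.1 - w q.2| ^ p)
        ((volume.restrict D).prod (volume.restrict D)) :=
      ((h1.comp_fst.sub h1.comp_snd).abs).pow_const p
    have h3 : AEMeasurable (fun q : Euc n × Euc n => ‖q.1 - q.2‖ ^ ((n : ℝ) + σ * p))
        ((volume.restrict D).prod (volume.restrict D)) :=
      ((measurable_fst.sub measurable_snd).norm.pow_const _).aemeasurable
    exact (h2.div h3).aestronglyMeasurable
  · rw [hasFiniteIntegral_iff_norm]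
    refine lt_of_le_of_lt (lintegral_mono fun q => ?_) h
    rw [Real.norm_of_nonneg (slobodeckij_nonneg _ _ _ _)]

theorem holderClassOn_of_sobolevNormP_lt_top {D : Set (Euc n)} (hD : IsOpen D)
    (hb : Bornology.IsBounded D) (hcone : IsConeType D) {s p : ℝ} (hs : 0 < s) (hp : 1 < p)
    {u : Euc n → ℝ} (huc : ContinuousOn u D) {g : (Fin n → ℕ) → Euc n → ℝ}
    (hg : ∀ α, degree α = ⌊s⌋₊ → IsWeakDeriv D α u (g α))
    (hgi : ∀ α, degree α = ⌊s⌋₊ → LocallyIntegrableOn (g α) D)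
    (h : sobolevNormP p s D u g < ⊤) {t : ℝ} (ht0 : 0 ≤ t) (ht : t < s - n / p) :
    HolderClassOn t u D := by
  rw [sobolevNormP, ENNReal.add_lt_top] at h
  have hu : IsSlobodeckij D ⌊s⌋₊ (s - ⌊s⌋₊) p u g :=
    ⟨integrableOn_of_lintegral_rpow_lt_top hD hb hp huc h.1, hg, hgi, fun α hα =>
      integrableOn_slobodeckij_of_lintegral_lt_top (hgi α hα)
        ((ENNReal.le_tsum (⟨α, hα⟩ : {α : Fin n → ℕ // degree α = ⌊s⌋₊})).trans_lt h.2)⟩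
  exact hu.holderClassOn hD hb hcone (sub_nonneg.2 (Nat.floor_le hs.le)) hp huc ht0
    (by linarith)

/-! ### Local integrability of weak derivatives -/

theorem integrableOn_mul_multiDeriv {D : Set (Euc n)} {u : Euc n → ℝ} (huc : ContinuousOn u D)
    {φ : Euc n → ℝ} (hφ : ContDiff ℝ (⊤ : ℕ∞) φ) (hc : HasCompactSupport φ)
    (hs : tsupport φ ⊆ D) (α : Fin n → ℕ) :
    IntegrableOn (fun x => u x * multiDeriv α φ x) D := by
  have hk : IsKernel (tsupport φ) (multiDeriv α φ) :=
    IsKernel.multiDeriv (isClosed_tsupport φ) ⟨hφ, fun _ => image_eq_zero_of_notMem_tsupport⟩ α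
  have hT : IntegrableOn (fun x => u x * multiDeriv α φ x) (tsupport φ) :=
    ((huc.mono hs).mul hk.1.continuous.continuousOn).integrableOn_compact hc
  refine ((integrableOn_iff_integrable_of_support_subset fun x hx => ?_).1 hT).integrableOn
  by_contra hx'
  exact hx (by simp [hk.2 x hx'])

/-- A weak derivative in the sense of `IsWeakDeriv` is locally integrable, unless non-integrable
pairings force `u` to be orthogonal to all derivatives of test functions. -/
theorem IsWeakDeriv.locallyIntegrableOn_or_zero {D : Set (Euc n)} (hD : IsOpen D)
    {α : Fin n → ℕ} {u g : Euc n → ℝ} (huc : ContinuousOn u D) (h : IsWeakDeriv D α u g) :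
    LocallyIntegrableOn g D ∨ IsWeakDeriv D α u 0 := by
  by_cases hg : LocallyIntegrableOn g D
  · exact .inl hg
  right
  obtain ⟨x, hx, hgx⟩ : ∃ x ∈ D, ¬IntegrableAtFilter g (𝓝[D] x) := by
    simpa [LocallyIntegrableOn] using hg
  obtain ⟨ρ, hρ, hball⟩ := Metric.nhds_basis_closedBall.mem_iff.1 (hD.mem_nhds hx)
  let b : ContDiffBump x := ⟨ρ / 2, ρ, half_pos hρ, half_lt_self hρ⟩
  have hbs : ContDiff ℝ (⊤ : ℕ∞) b := b.contDiff
  have hbD : tsupport b ⊆ D := by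
    rw [b.tsupport_eq]
    exact hball
  have hgb : ¬IntegrableOn (fun y => g y * b y) D := by
    intro hi
    refine hgx ⟨D ∩ closedBall x (ρ / 2),
      inter_mem_nhdsWithin D (closedBall_mem_nhds x (half_pos hρ)), ?_⟩
    refine (hi.mono_set inter_subset_left).congr_fun (fun y hy => ?_)
      (hD.measurableSet.inter isClosed_closedBall.measurableSet)
    have : b y = 1 := b.one_of_mem_closedBall hy.2
    simp [this]
  have zero_of : ∀ φ : Euc n → ℝ, ContDiff ℝ (⊤ : ℕ∞) φ → HasCompactSupport φ →
      tsupport φ ⊆ D → ¬IntegrableOn (fun y => g y * φ y) D →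
      ∫ y in D, u y * multiDeriv α φ y = 0 := by
    intro φ h1 h2 h3 h4
    rw [h φ h1 h2 h3, integral_undef h4, mul_zero]
  intro φ hφ hφc hφD
  simp only [Pi.zero_apply, zero_mul, integral_zero, mul_zero]
  by_cases hi : IntegrableOn (fun y => g y * φ y) D
  · have hsum : ¬IntegrableOn (fun y => g y * (φ + b) y) D := by
      intro hi'
      refine hgb ((hi'.sub hi).congr (Eventually.of_forall fun y => ?_))
      simp only [Pi.sub_apply, Pi.add_apply]
      ring
    have h1 := zero_of (φ + b) (hφ.add hbs) (hφc.add b.hasCompactSupport)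
      ((tsupport_add φ b).trans (union_subset hφD hbD)) hsum
    have h2 := zero_of b hbs b.hasCompactSupport hbD hgb
    rw [multiDeriv_add hφ hbs] at h1
    simp only [Pi.add_apply, mul_add] at h1
    rw [integral_add (integrableOn_mul_multiDeriv huc hφ hφc hφD α)
      (integrableOn_mul_multiDeriv huc hbs b.hasCompactSupport hbD α), h2, add_zero] at h1
    exact h1
  · exact zero_of φ hφ hφc hφD hi

/-! ### Jointly measurable weak derivatives -/

/-- The weak derivative of order `α` of `u`, mollified by `η`. -/
def mollifiedDeriv (D : Set (Euc n)) (α : Fin n → ℕ) (η u : Euc n → ℝ) (x : Euc n) : ℝ :=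
  ∫ y in D, u y * multiDeriv α η (x - y)

theorem IsWeakDeriv.mollifiedDeriv_eq {D : Set (Euc n)} {α : Fin n → ℕ} {u g : Euc n → ℝ}
    (h : IsWeakDeriv D α u g) {η : Euc n → ℝ} {ρ : ℝ} (hη : IsKernel (closedBall 0 ρ) η)
    {x : Euc n} (hx : closedBall x ρ ⊆ D) :
    mollifiedDeriv D α η u x = ∫ y in D, g y * η (x - y) := by
  have e : ∀ y, (-1 : ℝ) • (y - x) = x - y := fun y => by rw [neg_one_smul, neg_sub]
  have hk : IsKernel (closedBall x ρ) (fun y => η ((-1 : ℝ) • (y - x))) := by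
    refine ⟨hη.1.comp (by fun_prop), fun y hy => hη.2 _ fun hz => hy ?_⟩
    rw [e, mem_closedBall_zero_iff, ← dist_eq_norm, dist_comm] at hz
    exact hz
  have hB := isCompact_closedBall x ρ
  have := h _ hk.1 (hk.hasCompactSupport hB) ((hk.tsupport_subset hB.isClosed).trans hx)
  rw [multiDeriv_comp_homothety hη.1] at this
  simp only [e, mul_left_comm _ ((-1 : ℝ) ^ degree α)] at this
  rw [integral_const_mul] at this
  exact mul_left_cancel₀ (pow_ne_zero _ (by norm_num)) this

/-- A sequence of bump functions shrinking to the origin. -/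
def shrinkingBump (n j : ℕ) : ContDiffBump (0 : Euc n) :=
  ⟨1 / ((j : ℝ) + 1) / 2, 1 / ((j : ℝ) + 1), by positivity, half_lt_self (by positivity)⟩

theorem tendsto_rOut_shrinkingBump (n : ℕ) :
    Tendsto (fun j => (shrinkingBump n j).rOut) atTop (𝓝 0) :=
  tendsto_one_div_add_atTop_nhds_zero_nat

theorem isKernel_normed {ρ : ℝ} (b : ContDiffBump (0 : Euc n)) (hb : b.rOut ≤ ρ) :
    IsKernel (closedBall 0 ρ) (b.normed volume) := by
  refine ⟨b.contDiff_normed, fun z hz => ?_⟩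
  refine Function.notMem_support.1 fun hz' => hz ?_
  rw [b.support_normed_eq] at hz'
  exact closedBall_subset_closedBall hb (ball_subset_closedBall hz')

theorem IsWeakDeriv.ae_tendsto_mollifiedDeriv {D : Set (Euc n)} (hD : IsOpen D)
    {α : Fin n → ℕ} {u g : Euc n → ℝ} (h : IsWeakDeriv D α u g) (hg : LocallyIntegrableOn g D) :
    ∀ᵐ x ∂volume.restrict D, Tendsto
      (fun j => mollifiedDeriv D α ((shrinkingBump n j).normed volume) u x) atTop (𝓝 (g x)) := by
  rw [ae_restrict_iff' hD.measurableSet]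
  refine measure_null_of_locally_null _ fun x₀ hx₀ => ?_
  have hx₀D : x₀ ∈ D := by
    by_contra hx
    exact hx₀ fun hx' => absurd hx' hx
  obtain ⟨δ, hδ, hball⟩ := Metric.nhds_basis_closedBall.mem_iff.1 (hD.mem_nhds hx₀D)
  set ρ := δ / 2 with hρ
  have hρ0 : 0 < ρ := half_pos hδ
  have hB : MeasurableSet (closedBall x₀ δ) := isClosed_closedBall.measurableSet
  have hG : LocallyIntegrable ((closedBall x₀ δ).indicator g) :=
    ((hg.integrableOn_compact_subset hball (isCompact_closedBall x₀ δ)).integrable_indicator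
      hB).locallyIntegrable
  have hconv := ContDiffBump.ae_convolution_tendsto_right_of_locallyIntegrable
    (φ := shrinkingBump n) (l := atTop) (K := 2) (tendsto_rOut_shrinkingBump n)
    (Eventually.of_forall fun j => by
      simp only [shrinkingBump]
      linarith) hG
  have hnull := ae_iff.1 hconv
  refine ⟨_, inter_mem self_mem_nhdsWithin (mem_nhdsWithin_of_mem_nhds (ball_mem_nhds x₀ hρ0)),
    measure_mono_null (fun x hx => ?_) hnull⟩
  refine mem_ofPred.2 fun hx' => hx.1 fun _ => ?_
  have hxδ : x ∈ closedBall x₀ δ :=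
    closedBall_subset_closedBall (by linarith) (ball_subset_closedBall hx.2)
  rw [indicator_of_mem hxδ] at hx'
  refine hx'.congr' ?_
  filter_upwards [(tendsto_rOut_shrinkingBump n).eventually_lt_const hρ0] with j hj
  have hk := isKernel_normed (shrinkingBump n j) hj.le
  have hsub : closedBall x ρ ⊆ closedBall x₀ δ := by
    refine closedBall_subset_closedBall' ?_
    have := mem_ball.1 hx.2
    linarith
  rw [h.mollifiedDeriv_eq hk (hsub.trans hball), convolution_lsmul_swap,
    ← integral_indicator hD.measurableSet]
  refine integral_congr_ae (Eventually.of_forall fun y => ?_)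
  by_cases hy : y ∈ closedBall x₀ δ
  · simp only [indicator_of_mem hy, indicator_of_mem (hball hy), smul_eq_mul, mul_comm]
  · have h0 : (shrinkingBump n j).normed volume (x - y) = 0 := by
      refine hk.2 _ fun hz => hy (hsub ?_)
      rwa [mem_closedBall_zero_iff, ← dist_eq_norm, dist_comm] at hz
    simp [indicator, h0]

theorem exists_measurable_weakDeriv {Ω : Type*} [MeasurableSpace Ω] {D : Set (Euc n)}
    (hD : IsOpen D) {X : Ω → Euc n → ℝ} (hX : Measurable (Function.uncurry X)) {α : Fin n → ℕ}
    {g : Ω → Euc n → ℝ} (h : ∀ ω, IsWeakDeriv D α (X ω) (g ω))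
    (hg : ∀ ω, LocallyIntegrableOn (g ω) D) :
    ∃ G : Ω → Euc n → ℝ, Measurable (Function.uncurry G) ∧
      ∀ ω, G ω =ᵐ[volume.restrict D] g ω := by
  refine ⟨fun ω x => limUnder atTop
    fun j => mollifiedDeriv D α ((shrinkingBump n j).normed volume) (X ω) x, ?_, fun ω => ?_⟩
  · refine (StronglyMeasurable.limUnder (l := atTop) (f := fun (j : ℕ) (q : Ω × Euc n) =>
      mollifiedDeriv D α ((shrinkingBump n j).normed volume) (X q.1) q.2)
      fun j => ?_).measurable
    have hc : Continuous (multiDeriv α ((shrinkingBump n j).normed volume)) :=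
      (contDiff_multiDeriv (shrinkingBump n j).contDiff_normed α).continuous
    refine StronglyMeasurable.integral_prod_right' (f := fun q : (Ω × Euc n) × Euc n =>
      X q.1.1 q.2 * multiDeriv α ((shrinkingBump n j).normed volume) (q.1.2 - q.2)) ?_
    refine Measurable.stronglyMeasurable (Measurable.mul ?_ ?_)
    · exact hX.comp ((measurable_fst.comp measurable_fst).prodMk measurable_snd)
    · exact hc.measurable.comp ((measurable_snd.comp measurable_fst).sub measurable_snd)
  · filter_upwards [(h ω).ae_tendsto_mollifiedDeriv hD (hg ω)] with x hx using hx.limUnder_eq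

theorem sobolevNormP_congr {p s : ℝ} {D : Set (Euc n)} {u : Euc n → ℝ}
    {g g' : (Fin n → ℕ) → Euc n → ℝ}
    (h : ∀ α, degree α = ⌊s⌋₊ → g α =ᵐ[volume.restrict D] g' α) :
    sobolevNormP p s D u g = sobolevNormP p s D u g' := by
  unfold sobolevNormP
  congr 1
  refine tsum_congr fun α => ?_
  rw [Measure.volume_eq_prod, ← Measure.prod_restrict]
  refine lintegral_congr_ae ?_
  filter_upwards [Measure.quasiMeasurePreserving_fst.ae_eq_comp (h α.1 α.2),
    Measure.quasiMeasurePreserving_snd.ae_eq_comp (h α.1 α.2)] with q h1 h2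
  simp only [Function.comp_apply] at h1 h2
  rw [h1, h2]

theorem measurable_sobolevNormP {Ω : Type*} [MeasurableSpace Ω] {D : Set (Euc n)} {p s : ℝ}
    {X : Ω → Euc n → ℝ} (hX : Measurable (Function.uncurry X))
    {G : (Fin n → ℕ) → Ω → Euc n → ℝ}
    (hG : ∀ α, degree α = ⌊s⌋₊ → Measurable (Function.uncurry (G α))) :
    Measurable fun ω => sobolevNormP p s D (X ω) fun α => G α ω := by
  unfold sobolevNormP
  refine Measurable.add ?_ (Measurable.tsum fun α => ?_)
  · exact Measurable.lintegral_prod_right' (f := fun q : Ω × Euc n =>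
      ENNReal.ofReal (|X q.1 q.2| ^ p)) (hX.abs.pow_const p).ennreal_ofReal
  · have h1 : Measurable fun q : Ω × Euc n × Euc n => G α.1 q.1 q.2.1 :=
      (hG α.1 α.2).comp (measurable_fst.prodMk (measurable_fst.comp measurable_snd))
    have h2 : Measurable fun q : Ω × Euc n × Euc n => G α.1 q.1 q.2.2 :=
      (hG α.1 α.2).comp (measurable_fst.prodMk (measurable_snd.comp measurable_snd))
    have h3 : Measurable fun q : Ω × Euc n × Euc n => ‖q.2.1 - q.2.2‖ :=
      ((measurable_fst.comp measurable_snd).sub (measurable_snd.comp measurable_snd)).norm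
    exact Measurable.lintegral_prod_right' (f := fun q : Ω × Euc n × Euc n => ENNReal.ofReal
      (|G α.1 q.1 q.2.1 - G α.1 q.1 q.2.2| ^ p /
        ‖q.2.1 - q.2.2‖ ^ ((n : ℝ) + (s - ⌊s⌋₊) * p)))
      (((h1.sub h2).abs.pow_const p).div (h3.pow_const _)).ennreal_ofReal

theorem sobolevNormP_le_of_eq_or_eq_zero {p s : ℝ} (hp : 1 < p) {D : Set (Euc n)}
    {u : Euc n → ℝ} {g g' : (Fin n → ℕ) → Euc n → ℝ}
    (h : ∀ α, degree α = ⌊s⌋₊ → g' α = g α ∨ g' α = 0) :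
    sobolevNormP p s D u g' ≤ sobolevNormP p s D u g := by
  unfold sobolevNormP
  refine add_le_add le_rfl (ENNReal.tsum_le_tsum fun α =>
    lintegral_mono fun q => ENNReal.ofReal_le_ofReal ?_)
  rcases h α.1 α.2 with h | h
  · rw [h]
  · rw [h, Pi.zero_apply, Pi.zero_apply, sub_self, abs_zero, Real.zero_rpow (by linarith), zero_div]
    exact div_nonneg (Real.rpow_nonneg (abs_nonneg _) _) (Real.rpow_nonneg (norm_nonneg _) _)

theorem isWeakDeriv_zero (D : Set (Euc n)) (α : Fin n → ℕ) : IsWeakDeriv D α 0 0 := by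
  intro φ _ _ _
  simp

theorem sobolevNormP_zero {p : ℝ} (hp : 1 < p) (s : ℝ) (D : Set (Euc n)) :
    sobolevNormP p s D 0 (fun _ => 0) = 0 := by
  unfold sobolevNormP
  simp [Real.zero_rpow (by linarith : p ≠ 0)]

theorem holderClassOn_zero (t : ℝ) (D : Set (Euc n)) : HolderClassOn t 0 D := by
  refine ⟨contDiffOn_const, fun α _ => ⟨0, ?_, ?_⟩⟩ <;> simp [multiDeriv_zero]

/-- A continuous random field with `E‖X‖^p_{W^s_p(D)} < ∞` on a bounded domain of
cone type has a modification `X̃ = 1_{Ω'} X` (for some full-measure `Ω'`) all of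
whose sample paths lie in `W^s_p(D)` and in `C̄^t(D)` for every `t < s - n/p`. -/
theorem stmt16 {n : ℕ} {Ω : Type*} [MeasurableSpace Ω] (P : Measure Ω)
    [IsProbabilityMeasure P]
    (D : Set (Euc n)) (hne : D.Nonempty) (hopen : IsOpen D)
    (hconn : IsConnected D) (hbdd : Bornology.IsBounded D) (hcone : IsConeType D)
    (X : Ω → Euc n → ℝ) (hmeas : Measurable (Function.uncurry X))
    (hcont : ∀ ω, ContinuousOn (X ω) D)
    (s p : ℝ) (hs : 0 < s) (hp : 1 < p)
    (g : (Fin n → ℕ) → Ω → Euc n → ℝ)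
    (hweak : ∀ α : Fin n → ℕ, degree α = ⌊s⌋₊ → ∀ ω, IsWeakDeriv D α (X ω) (g α ω))
    (hEsob : ∫⁻ ω, sobolevNormP p s D (X ω) (fun α => g α ω) ∂P < ⊤) :
    ∃ Ω' : Set Ω, MeasurableSet Ω' ∧ P Ω' = 1 ∧
      ((∀ x ∈ D, ∀ᵐ ω ∂P,
          (fun (ω' : Ω) (y : Euc n) => Set.indicator Ω' (fun ω'' => X ω'' y) ω') ω x
            = X ω x) ∧
        (∀ ω, ∃ g' : (Fin n → ℕ) → Euc n → ℝ,
          (∀ α : Fin n → ℕ, degree α = ⌊s⌋₊ →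
            IsWeakDeriv D α
              (fun y => Set.indicator Ω' (fun ω'' => X ω'' y) ω) (g' α)) ∧
          sobolevNormP p s D
            (fun y => Set.indicator Ω' (fun ω'' => X ω'' y) ω) g' < ⊤) ∧
        ∀ ω, ∀ t : ℝ, 0 ≤ t → t < s - n / p →
          HolderClassOn t
            (fun y => Set.indicator Ω' (fun ω'' => X ω'' y) ω) D) := by
  have hexists : ∀ α ω, ∃ g' : Euc n → ℝ, degree α = ⌊s⌋₊ →
      IsWeakDeriv D α (X ω) g' ∧ LocallyIntegrableOn g' D ∧ (g' = g α ω ∨ g' = 0) := by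
    intro α ω
    by_cases hα : degree α = ⌊s⌋₊
    · rcases (hweak α hα ω).locallyIntegrableOn_or_zero hopen (hcont ω) with h | h
      · exact ⟨_, fun _ => ⟨hweak α hα ω, h, .inl rfl⟩⟩
      · exact ⟨0, fun _ => ⟨h, (locallyIntegrable_zero).locallyIntegrableOn D, .inr rfl⟩⟩
    · exact ⟨0, fun h => absurd h hα⟩
  choose g' hg' using hexists
  have hmeasurable : ∀ α, ∃ G : Ω → Euc n → ℝ, degree α = ⌊s⌋₊ →
      Measurable (Function.uncurry G) ∧ ∀ ω, G ω =ᵐ[volume.restrict D] g' α ω := by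
    intro α
    by_cases hα : degree α = ⌊s⌋₊
    · obtain ⟨G, hG⟩ := exists_measurable_weakDeriv hopen hmeas
        (fun ω => (hg' α ω hα).1) (fun ω => (hg' α ω hα).2.1)
      exact ⟨G, fun _ => hG⟩
    · exact ⟨0, fun h => absurd h hα⟩
  choose G hG using hmeasurable
  set N : Ω → ℝ≥0∞ := fun ω => sobolevNormP p s D (X ω) fun α => G α ω with hN
  have hNm : Measurable N := measurable_sobolevNormP hmeas fun α hα => (hG α hα).1
  have hNeq : ∀ ω, N ω = sobolevNormP p s D (X ω) fun α => g' α ω := fun ω =>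
    sobolevNormP_congr fun α hα => (hG α hα).2 ω
  have hNint : ∫⁻ ω, N ω ∂P ≠ ⊤ := by
    refine (lt_of_le_of_lt (lintegral_mono fun ω => ?_) hEsob).ne
    rw [hNeq]
    exact sobolevNormP_le_of_eq_or_eq_zero hp fun α hα => (hg' α ω hα).2.2
  have hΩ : MeasurableSet {ω | N ω < ⊤} := hNm measurableSet_Iio
  have hae : ∀ᵐ ω ∂P, ω ∈ {ω | N ω < ⊤} := ae_lt_top hNm hNint
  have hin : ∀ ω ∈ {ω | N ω < ⊤},
      (fun y => indicator {ω | N ω < ⊤} (fun ω' => X ω' y) ω) = X ω := fun ω hω =>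
    funext fun y => indicator_of_mem hω _
  have hout : ∀ ω ∉ {ω | N ω < ⊤},
      (fun y => indicator {ω | N ω < ⊤} (fun ω' => X ω' y) ω) = 0 := fun ω hω =>
    funext fun y => indicator_of_notMem hω _
  refine ⟨{ω | N ω < ⊤}, hΩ, (prob_compl_eq_zero_iff hΩ).1 hae,
    fun x _ => hae.mono fun ω hω => congrFun (hin ω hω) x, fun ω => ?_, fun ω t ht0 ht => ?_⟩
  · by_cases hω : ω ∈ {ω | N ω < ⊤}
    · rw [hin ω hω]
      exact ⟨fun α => g' α ω, fun α hα => (hg' α ω hα).1, (hNeq ω).symm.trans_lt hω⟩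
    · rw [hout ω hω]
      refine ⟨fun _ => 0, fun α _ => isWeakDeriv_zero D α, ?_⟩
      rw [sobolevNormP_zero hp]
      exact ENNReal.zero_lt_top
  · by_cases hω : ω ∈ {ω | N ω < ⊤}
    · rw [hin ω hω]
      exact holderClassOn_of_sobolevNormP_lt_top hopen hbdd hcone hs hp (hcont ω)
        (fun α hα => (hg' α ω hα).1) (fun α hα => (hg' α ω hα).2.1)
        ((hNeq ω).symm.trans_lt hω) ht0 ht
    · rw [hout ω hω]
      exact holderClassOn_zero t D

end
end
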